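/- Fix a prime p, a commutative ring R of characteristic p, m, n ∈ ℕ, an ideal I of B_{m,n}(R), and set C = B_{m,n}(R)/I. Then for all m' ≤ m and n' ≤ n, the centralizer in C of the images of x_0,…,x_{m'−1}, y_0,…,y_{n'−1} equals the image in C of the subalgebra R[x_0^{p^{n'}},…,x_{m−1}^{p^{n'}}][y_0^{p^{m'}},…,y_{n−1}^{p^{m'}}] of B_{m,n}(R) (the span of the monomials in x_0^{p^{n'}},…,x_{m−1}^{p^{n'}} times monomials in y_0^{p^{m'}},…,y_{n−1}^{p^{m'}}). In particular, the center of C is the image of R[x_0^{p^n},…,x_{m−1}^{p^n}, y_0^{p^m},…,y_{n−1}^{p^m}]. -/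

import Mathlib

noncomputable section

/-- The product `∏ i, x i ^ e i` over the support of `e`, with factors multiplied in
increasing order of the index. -/
def ordProd {σ M : Type*} [LinearOrder σ] [Monoid M] (x : σ → M) (e : σ →₀ ℕ) : M :=
  ((e.support.sort (· ≤ ·)).map fun i => x i ^ e i).prod

/-- Evaluation of a multivariate polynomial in a (possibly noncommutative) algebra:
each monomial is evaluated as the ordered product of the powers of the substituted
values, the variables being multiplied in increasing order of their (linearly ordered)
index. -/
def pEval {σ R A : Type*} [LinearOrder σ] [CommSemiring R] [Semiring A] [Algebra R A]
    (x : σ → A) (q : MvPolynomial σ R) : A :=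
  q.support.sum fun e => MvPolynomial.coeff e q • ordProd x e

/-- Evaluation of an integral polynomial in the commuting variables `X_d` (`d : ℕ+`, left
summand) and `Y_e` (`e : ℕ+`, right summand), substituting `x d` for `X_d` and `y e` for
`Y_e`; in each monomial all `X`-factors (in increasing index order) are multiplied to the
left of all `Y`-factors (in increasing index order), as appropriate for a polynomial in
`ℤ[X][Y]`. -/
def cEval {A : Type*} [Ring A] (x y : ℕ+ → A) (q : MvPolynomial (ℕ+ ⊕ₗ ℕ+) ℤ) : A :=
  pEval (fun v => Sum.elim x y (ofLex v)) q

/-- The `k`-th ghost value `w_k(g) = ∑_{d ∣ k} d · (g d)^(k/d)`. -/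
def ghost {A : Type*} [Ring A] (g : ℕ+ → A) (k : ℕ+) : A :=
  ∑ d ∈ (k : ℕ).divisors.attach,
    ((d : ℕ) : A) * g ⟨(d : ℕ), Nat.pos_of_mem_divisors d.2⟩ ^ ((k : ℕ) / (d : ℕ))

/-- The generator `x_d` of the free algebra underlying `B(ℚ)`. -/
def bXf (d : ℕ+) : FreeAlgebra ℚ (ℕ+ ⊕ ℕ+) := FreeAlgebra.ι ℚ (Sum.inl d)

/-- The generator `y_e` of the free algebra underlying `B(ℚ)`. -/
def bYf (e : ℕ+) : FreeAlgebra ℚ (ℕ+ ⊕ ℕ+) := FreeAlgebra.ι ℚ (Sum.inr e)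

/-- The defining relations of `B(ℚ)`: `[w_k(x), w_l(x)] = 0`, `[w_k(y), w_l(y)] = 0` and
`[w_l(y), w_k(x)] = δ_{k,l}·k` for all `k, l ≥ 1`. -/
inductive BRel : FreeAlgebra ℚ (ℕ+ ⊕ ℕ+) → FreeAlgebra ℚ (ℕ+ ⊕ ℕ+) → Prop
  | xx (k l : ℕ+) : BRel (ghost bXf k * ghost bXf l) (ghost bXf l * ghost bXf k)
  | yy (k l : ℕ+) : BRel (ghost bYf k * ghost bYf l) (ghost bYf l * ghost bYf k)
  | yx (k l : ℕ+) : BRel (ghost bYf l * ghost bXf k)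
      (ghost bXf k * ghost bYf l + if k = l then ((k : ℕ) : FreeAlgebra ℚ (ℕ+ ⊕ ℕ+)) else 0)

/-- The universal algebra `B(ℚ)`. -/
abbrev BQ : Type := RingQuot BRel

/-- The generator `x_d` of `B(ℚ)`. -/
def bx (d : ℕ+) : BQ := RingQuot.mkAlgHom ℚ BRel (bXf d)

/-- The generator `y_e` of `B(ℚ)`. -/
def by' (e : ℕ+) : BQ := RingQuot.mkAlgHom ℚ BRel (bYf e)

/-- `c` is a family of polynomials `c_{m,n}` as in the paper: `c m n` is an integral
polynomial in the variables `X_d` (`d` a proper divisor of `m`) and `Y_e` (`e` a proper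
divisor of `n`) such that `[y_n, x_m] = c_{m,n}(x, y)` holds in `B(ℚ)`. -/
def IsCFamily (c : ℕ+ → ℕ+ → MvPolynomial (ℕ+ ⊕ₗ ℕ+) ℤ) : Prop :=
  ∀ m n : ℕ+,
    (∀ v ∈ (c m n).vars,
      (∃ d : ℕ+, (d : ℕ) ∣ (m : ℕ) ∧ d ≠ m ∧ ofLex v = Sum.inl d) ∨
      (∃ e : ℕ+, (e : ℕ) ∣ (n : ℕ) ∧ e ≠ n ∧ ofLex v = Sum.inr e)) ∧
    cEval bx by' (c m n) = by' n * bx m - bx m * by' n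


/-- `p ^ i` as a positive natural number. -/
def ppow (p i : ℕ) : ℕ+ := (p ^ i).toPNat'

/-- Substitution of the generators `x_0, …, x_{m-1}` for the variables `X_{p^0}, …, X_{p^{m-1}}`
(the variable `X_{p^r}` is sent to `x_r`). -/
def sxm (R : Type*) [CommRing R] (p m n : ℕ) : ℕ+ → FreeAlgebra R (Fin m ⊕ Fin n) :=
  fun d => if h : padicValNat p (d : ℕ) < m
    then FreeAlgebra.ι R (Sum.inl ⟨padicValNat p (d : ℕ), h⟩) else 0

/-- Substitution of the generators `y_0, …, y_{n-1}` for the variables `Y_{p^0}, …, Y_{p^{n-1}}`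
(the variable `Y_{p^s}` is sent to `y_s`). -/
def syn (R : Type*) [CommRing R] (p m n : ℕ) : ℕ+ → FreeAlgebra R (Fin m ⊕ Fin n) :=
  fun e => if h : padicValNat p (e : ℕ) < n
    then FreeAlgebra.ι R (Sum.inr ⟨padicValNat p (e : ℕ), h⟩) else 0

/-- The defining relations of the truncated `p`-typical algebra `B_{m,n}(R)`:
`[x_i, x_{i'}] = 0`, `[y_j, y_{j'}] = 0` and
`[y_j, x_i] = c_{p^i, p^j}(x_0, …, x_{i-1}, y_0, …, y_{j-1})`. -/
inductive BmnRel (R : Type*) [CommRing R] (p : ℕ)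
    (c : ℕ+ → ℕ+ → MvPolynomial (ℕ+ ⊕ₗ ℕ+) ℤ) (m n : ℕ) :
    FreeAlgebra R (Fin m ⊕ Fin n) → FreeAlgebra R (Fin m ⊕ Fin n) → Prop
  | xx (i i' : Fin m) : BmnRel R p c m n
      (FreeAlgebra.ι R (Sum.inl i) * FreeAlgebra.ι R (Sum.inl i'))
      (FreeAlgebra.ι R (Sum.inl i') * FreeAlgebra.ι R (Sum.inl i))
  | yy (j j' : Fin n) : BmnRel R p c m n
      (FreeAlgebra.ι R (Sum.inr j) * FreeAlgebra.ι R (Sum.inr j'))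
      (FreeAlgebra.ι R (Sum.inr j') * FreeAlgebra.ι R (Sum.inr j))
  | yx (i : Fin m) (j : Fin n) : BmnRel R p c m n
      (FreeAlgebra.ι R (Sum.inr j) * FreeAlgebra.ι R (Sum.inl i))
      (FreeAlgebra.ι R (Sum.inl i) * FreeAlgebra.ι R (Sum.inr j) +
        cEval (sxm R p m n) (syn R p m n) (c (ppow p (i : ℕ)) (ppow p (j : ℕ))))

/-- The truncated `p`-typical algebra `B_{m,n}(R)`. -/
abbrev Bmn (R : Type*) [CommRing R] (p : ℕ) (c : ℕ+ → ℕ+ → MvPolynomial (ℕ+ ⊕ₗ ℕ+) ℤ)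
    (m n : ℕ) : Type _ := RingQuot (BmnRel R p c m n)

/-- The generator `x_i` of `B_{m,n}(R)`. -/
def gx (R : Type*) [CommRing R] (p : ℕ) (c : ℕ+ → ℕ+ → MvPolynomial (ℕ+ ⊕ₗ ℕ+) ℤ)
    (m n : ℕ) (i : Fin m) : Bmn R p c m n :=
  RingQuot.mkAlgHom R (BmnRel R p c m n) (FreeAlgebra.ι R (Sum.inl i))

/-- The generator `y_j` of `B_{m,n}(R)`. -/
def gy (R : Type*) [CommRing R] (p : ℕ) (c : ℕ+ → ℕ+ → MvPolynomial (ℕ+ ⊕ₗ ℕ+) ℤ)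
    (m n : ℕ) (j : Fin n) : Bmn R p c m n :=
  RingQuot.mkAlgHom R (BmnRel R p c m n) (FreeAlgebra.ι R (Sum.inr j))

section CommEval

variable {R B σ : Type*} [CommRing R] [Ring B] [Algebra R B]

open scoped IsMulCommutative in
/-- Evaluation of commutative polynomials at a family of pairwise commuting elements of a
possibly noncommutative algebra. -/
def commEval (b : σ → B) (hb : ∀ i j, b i * b j = b j * b i) : MvPolynomial σ R →ₐ[R] B :=
  haveI : IsMulCommutative (Algebra.adjoin R (Set.range b)) :=
    Algebra.isMulCommutative_adjoin R (by rintro _ ⟨i, rfl⟩ _ ⟨j, rfl⟩; exact hb i j)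
  (Algebra.adjoin R (Set.range b)).val.comp
    (MvPolynomial.aeval fun i => ⟨b i, Algebra.subset_adjoin ⟨i, rfl⟩⟩)

@[simp]
theorem commEval_X (b : σ → B) (hb : ∀ i j, b i * b j = b j * b i) (i : σ) :
    commEval (R := R) b hb (MvPolynomial.X i) = b i := by
  simp [commEval]

theorem commEval_range (b : σ → B) (hb : ∀ i j, b i * b j = b j * b i) :
    (commEval (R := R) b hb).range = Algebra.adjoin R (Set.range b) := by
  have h := MvPolynomial.adjoin_range_X (R := R) (σ := σ)
  rw [← Algebra.map_top, ← h, AlgHom.map_adjoin, ← Set.range_comp]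
  congr 2
  ext i
  simp

theorem commEval_mem (b : σ → B) (hb : ∀ i j, b i * b j = b j * b i) (f : MvPolynomial σ R) :
    commEval b hb f ∈ Algebra.adjoin R (Set.range b) :=
  commEval_range (R := R) b hb ▸ AlgHom.mem_range_self _ f

end CommEval

section NormalForm

variable {R B ι κ : Type*} [CommRing R] [Ring B] [Algebra R B]

/-- If every `[y_j, x_i]` only involves the family `x` and the `y_k` with `k < j`, every element of the
algebra generated by `x` and `y` can be reordered with the factors `x_i` on the left. -/
theorem adjoin_le_adjoin_mul_adjoin [LT κ] [WellFoundedLT κ] (x : ι → B) (y : κ → B)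
    (hxy : ∀ i j, y j * x i - x i * y j ∈
      Algebra.adjoin R (Set.range x ∪ y '' {k | k < j})) :
    Subalgebra.toSubmodule (Algebra.adjoin R (Set.range x ∪ Set.range y)) ≤
      Subalgebra.toSubmodule (Algebra.adjoin R (Set.range x)) *
        Subalgebra.toSubmodule (Algebra.adjoin R (Set.range y)) := by
  set A := Algebra.adjoin R (Set.range x)
  set Y := Algebra.adjoin R (Set.range y)
  set M := Subalgebra.toSubmodule A * Subalgebra.toSubmodule Y
  have closed : ∀ S : Set B, (∀ s ∈ S, ∀ w ∈ M, s * w ∈ M) →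
      ∀ a ∈ Algebra.adjoin R S, ∀ w ∈ M, a * w ∈ M := by
    intro S hS a ha
    induction ha using Algebra.adjoin_induction with
    | mem s hs => exact hS s hs
    | algebraMap r => intro w hw; rw [← Algebra.smul_def]; exact M.smul_mem r hw
    | add a b _ _ iha ihb => intro w hw; rw [add_mul]; exact M.add_mem (iha w hw) (ihb w hw)
    | mul a b _ _ iha ihb => intro w hw; rw [mul_assoc]; exact iha _ (ihb w hw)
  have one_mem : (1 : B) ∈ M := by
    simpa using Submodule.mul_mem_mul (M := Subalgebra.toSubmodule A)
      (N := Subalgebra.toSubmodule Y) A.one_mem Y.one_mem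
  have leftA : ∀ a ∈ A, ∀ w ∈ M, a * w ∈ M := by
    intro a ha w hw
    induction hw using Submodule.mul_induction_on' with
    | mem_mul_mem b hb c hc =>
      rw [← mul_assoc]
      exact Submodule.mul_mem_mul (A.mul_mem ha hb) hc
    | add u _ v _ hu hv => rw [mul_add]; exact M.add_mem hu hv
  have leftx : ∀ i, ∀ w ∈ M, x i * w ∈ M := fun i =>
    leftA _ (Algebra.subset_adjoin ⟨i, rfl⟩)
  have lefty : ∀ j, ∀ w ∈ M, y j * w ∈ M := by
    intro j
    induction j using WellFoundedLT.induction with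
    | ind j ih =>
    have lower : ∀ a ∈ Algebra.adjoin R (Set.range x ∪ y '' {k | k < j}), ∀ w ∈ M,
        a * w ∈ M := by
      apply closed
      rintro _ (⟨i, rfl⟩ | ⟨k, hk, rfl⟩)
      · exact leftx i
      · exact ih k hk
    have key : ∀ a ∈ A, ∀ w ∈ M, y j * w ∈ M → y j * (a * w) ∈ M := by
      intro a ha
      induction ha using Algebra.adjoin_induction with
      | mem s hs =>
        obtain ⟨i, rfl⟩ := hs
        intro w hw hyw
        have : y j * (x i * w) = x i * (y j * w) + (y j * x i - x i * y j) * w := by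
          noncomm_ring
        rw [this]
        exact M.add_mem (leftx i _ hyw) (lower _ (hxy i j) w hw)
      | algebraMap r =>
        intro w hw hyw
        rw [← Algebra.smul_def, mul_smul_comm]
        exact M.smul_mem r hyw
      | add a b _ _ iha ihb =>
        intro w hw hyw
        rw [add_mul, mul_add]
        exact M.add_mem (iha w hw hyw) (ihb w hw hyw)
      | mul a b ha hb iha ihb =>
        intro w hw hyw
        rw [mul_assoc]
        exact iha _ (leftA b hb w hw) (ihb w hw hyw)
    intro w hw
    induction hw using Submodule.mul_induction_on' with
    | mem_mul_mem b hb c hc =>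
      have hcM : ∀ c ∈ Y, c ∈ M := fun c hc => by
        simpa using Submodule.mul_mem_mul (M := Subalgebra.toSubmodule A)
          (N := Subalgebra.toSubmodule Y) A.one_mem hc
      exact key b hb c (hcM c hc)
        (hcM _ (Y.mul_mem (Algebra.subset_adjoin ⟨j, rfl⟩) hc))
    | add u _ v _ hu hv => rw [mul_add]; exact M.add_mem hu hv
  intro a ha
  have := closed (Set.range x ∪ Set.range y) (by
    rintro _ (⟨i, rfl⟩ | ⟨j, rfl⟩)
    · exact leftx i
    · exact lefty j) a ha 1 one_mem
  simpa using this

open TensorProduct in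
/-- The linear map sending `f ⊗ g` to the normally ordered element `f(x) * g(y)`. -/
def normalForm (x : ι → B) (y : κ → B) (hx : ∀ i j, x i * x j = x j * x i)
    (hy : ∀ i j, y i * y j = y j * y i) :
    MvPolynomial ι R ⊗[R] MvPolynomial κ R →ₗ[R] B :=
  LinearMap.mul' R B ∘ₗ
    TensorProduct.map (commEval x hx).toLinearMap (commEval y hy).toLinearMap

@[simp]
theorem normalForm_tmul (x : ι → B) (y : κ → B) (hx : ∀ i j, x i * x j = x j * x i)
    (hy : ∀ i j, y i * y j = y j * y i) (f : MvPolynomial ι R) (g : MvPolynomial κ R) :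
    normalForm x y hx hy (f ⊗ₜ[R] g) = commEval x hx f * commEval y hy g := by
  simp [normalForm]

theorem adjoin_le_range_normalForm [LT κ] [WellFoundedLT κ] (x : ι → B) (y : κ → B)
    (hx : ∀ i j, x i * x j = x j * x i) (hy : ∀ i j, y i * y j = y j * y i)
    (hxy : ∀ i j, y j * x i - x i * y j ∈
      Algebra.adjoin R (Set.range x ∪ y '' {k | k < j})) :
    Subalgebra.toSubmodule (Algebra.adjoin R (Set.range x ∪ Set.range y)) ≤
      LinearMap.range (normalForm (R := R) x y hx hy) := by
  refine (adjoin_le_adjoin_mul_adjoin x y hxy).trans (Submodule.mul_le.2 ?_)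
  intro a ha b hb
  rw [← commEval_range x hx] at ha
  rw [← commEval_range y hy] at hb
  obtain ⟨f, rfl⟩ := ha
  obtain ⟨g, rfl⟩ := hb
  exact ⟨f ⊗ₜ g, by simp⟩

end NormalForm

section WittCommutators

variable {E : Type*} [Ring E]

/-- The `n`-th `p`-typical ghost component `∑_{s ≤ n} p^s g_s^{p^{n-s}}`. -/
def pGhost (p : ℕ) (g : ℕ → E) (n : ℕ) : E :=
  ∑ s ∈ Finset.range (n + 1), (p : E) ^ s * g s ^ p ^ (n - s)

theorem natCast_pow_mul_cancel {p : ℕ} (htf : ∀ a : E, (p : E) * a = 0 → a = 0) (n : ℕ)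
    {a b : E} (h : (p : E) ^ n * a = (p : E) ^ n * b) : a = b := by
  induction n with
  | zero => simpa using h
  | succ n ih =>
    rw [pow_succ', mul_assoc, mul_assoc] at h
    exact ih (sub_eq_zero.1 (htf _ (by rw [mul_sub, h, sub_self])))

theorem commute_natCast_pow_mul_iff {p : ℕ} (htf : ∀ a : E, (p : E) * a = 0 → a = 0) (n : ℕ)
    {a z : E} : Commute z ((p : E) ^ n * a) ↔ Commute z a := by
  have hp : Commute z ((p : E) ^ n) := ((Nat.cast_commute p z).pow_left n).symm
  refine ⟨fun h => natCast_pow_mul_cancel htf n ?_, fun h => hp.mul_right h⟩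
  rw [← mul_assoc, ← hp.eq, mul_assoc, h.eq, mul_assoc]

theorem commute_of_commute_pGhost {p : ℕ} (htf : ∀ a : E, (p : E) * a = 0 → a = 0)
    {g : ℕ → E} {z : E} {n : ℕ} (h : ∀ s ≤ n, Commute z (pGhost p g s)) :
    Commute z (g n) := by
  induction n using Nat.strong_induction_on with
  | _ n ih =>
  have hlow : Commute z (∑ s ∈ Finset.range n, (p : E) ^ s * g s ^ p ^ (n - s)) := by
    refine Commute.sum_right _ _ _ fun s hs => ?_
    rw [commute_natCast_pow_mul_iff htf]
    have hs := Finset.mem_range.1 hs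
    exact (ih s hs fun t ht => h t (ht.trans hs.le)).pow_right _
  have := (h n le_rfl).sub_right hlow
  rw [pGhost, Finset.sum_range_succ, add_sub_cancel_left, commute_natCast_pow_mul_iff htf] at this
  simpa using this

/-- The `k`-fold Frobenius lift `F^k` on the polynomial ring of Witt coordinates. -/
def frobIter (p : ℕ) [Fact p.Prime] :
    ℕ → MvPolynomial ℕ ℤ →ₐ[ℤ] MvPolynomial ℕ ℤ
  | 0 => AlgHom.id ℤ _
  | k + 1 => (MvPolynomial.bind₁ (WittVector.frobeniusPoly p)).comp (frobIter p k)

theorem frobIter_wittPolynomial (p : ℕ) [Fact p.Prime] (k n : ℕ) :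
    frobIter p k (wittPolynomial p ℤ n) = wittPolynomial p ℤ (n + k) := by
  induction k with
  | zero => rfl
  | succ k ih =>
    rw [frobIter, AlgHom.comp_apply, ih, WittVector.bind₁_frobeniusPoly_wittPolynomial]
    rfl

theorem dvd_frobIter_sub (p : ℕ) [Fact p.Prime] (k j : ℕ) :
    (p : MvPolynomial ℕ ℤ) ∣ frobIter p k (MvPolynomial.X j) - MvPolynomial.X j ^ p ^ k := by
  induction k with
  | zero => simp [frobIter]
  | succ k ih =>
    obtain ⟨h, hh⟩ := ih
    rw [sub_eq_iff_eq_add] at hh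
    have h1 : (p : MvPolynomial ℕ ℤ) ∣
        WittVector.frobeniusPoly p j ^ p ^ k - (MvPolynomial.X j ^ p) ^ p ^ k := by
      refine dvd_trans ?_ (sub_dvd_pow_sub_pow _ _ _)
      rw [WittVector.frobeniusPoly]
      simp
    obtain ⟨h', hh'⟩ := h1
    rw [sub_eq_iff_eq_add, ← pow_mul, ← pow_succ'] at hh'
    rw [frobIter, AlgHom.comp_apply, hh]
    simp only [map_add, map_mul, map_natCast, map_pow, MvPolynomial.bind₁_X_right, hh']
    exact ⟨MvPolynomial.bind₁ (WittVector.frobeniusPoly p) h + h', by ring⟩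

variable (p : ℕ) [Fact p.Prime] (x y : ℕ → E)
  (hx : ∀ i j, x i * x j = x j * x i)

theorem pGhost_frobIter (k n : ℕ) :
    pGhost p (fun j => commEval x hx (frobIter p k (MvPolynomial.X j))) n =
      pGhost p x (n + k) := by
  have h : ∀ (f : MvPolynomial ℕ ℤ →ₐ[ℤ] E) n,
      f (wittPolynomial p ℤ n) = pGhost p (fun j => f (MvPolynomial.X j)) n := by
    intro f n
    simp [wittPolynomial_eq_sum_C_mul_X_pow, pGhost]
  have h1 := h ((commEval x hx).comp (frobIter p k)) n
  have h2 := h (commEval x hx) (n + k)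
  rw [AlgHom.comp_apply, frobIter_wittPolynomial] at h1
  simp only [commEval_X] at h2
  rw [← h2, h1]
  rfl

variable (htf : ∀ a : E, (p : E) * a = 0 → a = 0)
  (hne : ∀ k l, l ≠ k → Commute (pGhost p y l) (pGhost p x k))

include htf hne

theorem commute_frobIter {l k j : ℕ} (h : ∀ s ≤ j, l ≠ s + k) :
    Commute (pGhost p y l) (commEval x hx (frobIter p k (MvPolynomial.X j))) := by
  refine commute_of_commute_pGhost (p := p) htf
    (g := fun j => commEval x hx (frobIter p k (MvPolynomial.X j))) fun s hs => ?_
  rw [pGhost_frobIter]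
  exact hne _ _ (h s hs)

theorem commute_generator_frobIter {l k : ℕ} (h : l < k) (j : ℕ) :
    Commute (y l) (commEval x hx (frobIter p k (MvPolynomial.X j))) :=
  (commute_of_commute_pGhost htf fun s hs =>
    (commute_frobIter p x y hx htf hne (by omega)).symm).symm

omit htf hne in
theorem commEval_frobIter_eq (k j : ℕ) : ∃ H ∈ Algebra.adjoin ℤ (Set.range x),
    commEval x hx (frobIter p k (MvPolynomial.X j)) = x j ^ p ^ k + (p : E) * H := by
  obtain ⟨h, hh⟩ := dvd_frobIter_sub p k j
  rw [sub_eq_iff_eq_add'] at hh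
  exact ⟨commEval x hx h, commEval_mem x hx h, by rw [hh]; simp⟩

include hx in
theorem exists_comm_pow_eq_mul {l k : ℕ} (h : l < k) (j : ℕ) :
    ∃ v ∈ Algebra.adjoin ℤ (Set.range x ∪ Set.range y),
      y l * x j ^ p ^ k - x j ^ p ^ k * y l = (p : E) * v := by
  obtain ⟨H, hH, hG⟩ := commEval_frobIter_eq p x hx k j
  have hc := (commute_generator_frobIter p x y hx htf hne h j).eq
  have hyl : y l ∈ Algebra.adjoin ℤ (Set.range x ∪ Set.range y) :=
    Algebra.subset_adjoin (Or.inr ⟨l, rfl⟩)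
  have hH' := Algebra.adjoin_mono (R := ℤ) (Set.subset_union_left (t := Set.range y)) hH
  refine ⟨H * y l - y l * H, sub_mem (mul_mem hH' hyl) (mul_mem hyl hH'), ?_⟩
  rw [hG, mul_add, add_mul] at hc
  have hpy : y l * ((p : E) * H) = p * (y l * H) := by
    rw [← mul_assoc, ← (Nat.cast_commute p (y l)).eq, mul_assoc]
  rw [mul_sub, ← mul_assoc _ H, ← hpy, sub_eq_sub_iff_add_eq_add, add_comm _ (x j ^ _ * _)]
  exact hc.trans (by rw [add_comm])

include hx in
theorem exists_comm_pow_pow_eq_one_add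
    (heq : ∀ k, pGhost p y k * pGhost p x k - pGhost p x k * pGhost p y k = (p : E) ^ k)
    (j k : ℕ) :
    ∃ v ∈ Algebra.adjoin ℤ (Set.range x ∪ Set.range y),
      y k ^ p ^ j * x j ^ p ^ k - x j ^ p ^ k * y k ^ p ^ j - 1 = (p : E) * v := by
  have hxT : ∀ i, x i ∈ Algebra.adjoin ℤ (Set.range x ∪ Set.range y) := fun i =>
    Algebra.subset_adjoin (Or.inl ⟨i, rfl⟩)
  have hyT : ∀ i, y i ∈ Algebra.adjoin ℤ (Set.range x ∪ Set.range y) := fun i =>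
    Algebra.subset_adjoin (Or.inr ⟨i, rfl⟩)
  set G : ℕ → E := fun s => commEval x hx (frobIter p k (MvPolynomial.X s)) with hG
  have central : ∀ (n : ℕ) (a b : E), a * ((p : E) ^ n * b) = (p : E) ^ n * (a * b) :=
    fun n a b => (((Nat.cast_commute p a).pow_left n).symm).left_comm b
  have hW : pGhost p y (j + k) * G j - G j * pGhost p y (j + k) = (p : E) ^ k := by
    have hlow : Commute (pGhost p y (j + k))
        (∑ s ∈ Finset.range j, (p : E) ^ s * G s ^ p ^ (j - s)) := by
      refine Commute.sum_right _ _ _ fun s hs => ?_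
      rw [commute_natCast_pow_mul_iff htf]
      have hs := Finset.mem_range.1 hs
      exact (commute_frobIter p x y hx htf hne fun t ht => by omega).pow_right _
    have hx' := pGhost_frobIter p x hx k j
    rw [pGhost, Finset.sum_range_succ, Nat.sub_self, pow_zero, pow_one,
      ← eq_sub_iff_add_eq'] at hx'
    refine natCast_pow_mul_cancel htf j ?_
    rw [mul_sub, ← central, ← mul_assoc _ (G j), hx', mul_sub, sub_mul, hlow.eq,
      sub_sub_sub_cancel_right, heq, pow_add]
  set Q : E := ∑ i ∈ Finset.range j, (p : E) ^ i * y (k + (i + 1)) ^ p ^ (j + k - (k + (i + 1)))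
  have hQ : Q ∈ Algebra.adjoin ℤ (Set.range x ∪ Set.range y) :=
    sum_mem fun i _ => mul_mem (pow_mem (natCast_mem _ p) i)
      (pow_mem (hyT _) _)
  have hdecomp : pGhost p y (j + k) =
      (∑ s ∈ Finset.range k, (p : E) ^ s * y s ^ p ^ (j + k - s)) +
        (p : E) ^ k * ((p : E) ^ 1 * Q + y k ^ p ^ j) := by
    rw [pGhost, show j + k + 1 = k + (j + 1) by ring, Finset.sum_range_add,
      Finset.sum_range_succ', add_zero, Nat.add_sub_cancel, mul_add, Finset.mul_sum,
      Finset.mul_sum]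
    congr 2
    refine Finset.sum_congr rfl fun i _ => ?_
    rw [← mul_assoc, ← mul_assoc, ← pow_add, ← pow_add]
    congr 2
    ring
  have hL : Commute (G j) (∑ s ∈ Finset.range k, (p : E) ^ s * y s ^ p ^ (j + k - s)) := by
    refine Commute.sum_right _ _ _ fun s hs => ?_
    rw [commute_natCast_pow_mul_iff htf]
    exact (commute_generator_frobIter p x y hx htf hne (Finset.mem_range.1 hs) j).symm.pow_right _
  have h1 : ((p : E) ^ 1 * Q + y k ^ p ^ j) * G j - G j * ((p : E) ^ 1 * Q + y k ^ p ^ j)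
      = 1 := by
    generalize (p : E) ^ 1 * Q + y k ^ p ^ j = u at hdecomp ⊢
    rw [hdecomp, add_mul, mul_add, ← hL.eq, add_sub_add_left_eq_sub] at hW
    refine natCast_pow_mul_cancel htf k ?_
    rw [mul_one, mul_sub, ← central k (G j), ← mul_assoc]
    exact hW
  obtain ⟨H, hH, hGH⟩ := commEval_frobIter_eq p x hx k j
  have hH' := Algebra.adjoin_mono (R := ℤ) (Set.subset_union_left (t := Set.range y)) hH
  have hxj : x j ^ p ^ k ∈ Algebra.adjoin ℤ (Set.range x ∪ Set.range y) :=
    pow_mem (hxT j) _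
  have hyk : y k ^ p ^ j ∈ Algebra.adjoin ℤ (Set.range x ∪ Set.range y) :=
    pow_mem (hyT k) _
  have hGj : G j = x j ^ p ^ k + (p : E) * H := hGH
  have hGm : G j ∈ Algebra.adjoin ℤ (Set.range x ∪ Set.range y) := by
    rw [hGj]
    exact add_mem hxj (mul_mem (natCast_mem _ p) hH')
  refine ⟨G j * Q - Q * G j - (y k ^ p ^ j * H - H * y k ^ p ^ j),
    sub_mem (sub_mem (mul_mem hGm hQ) (mul_mem hQ hGm))
      (sub_mem (mul_mem hyk hH') (mul_mem hH' hyk)), ?_⟩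
  rw [← h1, hGj]
  simp only [pow_one, ← nsmul_eq_mul, add_mul, mul_add, smul_mul_assoc, mul_smul_comm, smul_add,
    smul_sub]
  abel

end WittCommutators

section Ghost

variable {A A' : Type*} [Ring A] [Ring A']

theorem map_ghost {F : Type*} [FunLike F A A'] [RingHomClass F A A'] (f : F) (g : ℕ+ → A) (k : ℕ+) :
    f (ghost g k) = ghost (fun d => f (g d)) k := by
  simp [ghost]

theorem ghost_eq_sum_divisors (g : ℕ+ → A) (k : ℕ+) :
    ghost g k = ∑ d ∈ (k : ℕ).divisors, (d : A) * g d.toPNat' ^ ((k : ℕ) / d) := by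
  rw [ghost, ← Finset.sum_attach (k : ℕ).divisors]
  refine Finset.sum_congr rfl fun d _ => ?_
  congr 3
  exact PNat.eq (PNat.toPNat'_coe (Nat.pos_of_mem_divisors d.2)).symm

theorem ghost_eq_sum_properDivisors_add (g : ℕ+ → A) (k : ℕ+) :
    ghost g k = ∑ d ∈ (k : ℕ).properDivisors, (d : A) * g d.toPNat' ^ ((k : ℕ) / d) +
      (k : A) * g k := by
  rw [ghost_eq_sum_divisors, ← Nat.cons_self_properDivisors k.ne_zero, Finset.sum_cons, add_comm,
    Nat.div_self k.pos, pow_one, PNat.coe_toPNat']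

theorem toPNat'_lt_of_mem_properDivisors {d : ℕ} {k : ℕ+} (hd : d ∈ (k : ℕ).properDivisors) :
    d.toPNat' < k := by
  have := Nat.mem_properDivisors.1 hd
  rw [← PNat.coe_lt_coe, PNat.toPNat'_coe (Nat.pos_of_dvd_of_pos this.1 k.pos)]
  exact this.2

variable [Algebra ℚ A]

theorem natCast_mul_injective_of_rat (k : ℕ+) {a b : A} (h : (k : A) * a = (k : A) * b) :
    a = b := by
  have hk : ((k : ℕ) : ℚ) ≠ 0 := by exact_mod_cast k.ne_zero
  have h' : ((k : ℕ) : ℚ) • a = ((k : ℕ) : ℚ) • b := by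
    rw [Algebra.smul_def, Algebra.smul_def, map_natCast]
    exact h
  exact (smul_right_injective A hk) h'

theorem ghost_injective {g h : ℕ+ → A} (hgh : ∀ k, ghost g k = ghost h k) (k : ℕ+) :
    g k = h k := by
  induction k using PNat.strongInductionOn with
  | _ k ih =>
  have := hgh k
  rw [ghost_eq_sum_properDivisors_add, ghost_eq_sum_properDivisors_add,
    Finset.sum_congr rfl fun d hd => by rw [ih _ (toPNat'_lt_of_mem_properDivisors hd)]] at this
  exact natCast_mul_injective_of_rat k (add_left_cancel this)

theorem commute_of_commute_ghost {g : ℕ+ → A} {z : A} (hz : ∀ k, Commute z (ghost g k))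
    (k : ℕ+) : Commute z (g k) := by
  induction k using PNat.strongInductionOn with
  | _ k ih =>
  have hlow : Commute z
      (∑ d ∈ (k : ℕ).properDivisors, (d : A) * g d.toPNat' ^ ((k : ℕ) / d)) :=
    Commute.sum_right _ _ _ fun d hd => ((Nat.cast_commute d z).symm).mul_right
      ((ih _ (toPNat'_lt_of_mem_properDivisors hd)).pow_right _)
  have h := (hz k).sub_right hlow
  rw [ghost_eq_sum_properDivisors_add, add_sub_cancel_left] at h
  refine natCast_mul_injective_of_rat k ?_
  have hk : Commute ((k : ℕ) : A) z := Nat.cast_commute k z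
  rw [← mul_assoc, hk.eq, mul_assoc, h.eq, mul_assoc]

/-- The family whose ghost components are prescribed to be `a`. -/
def ghostInv (a : ℕ+ → A) (k : ℕ+) : A :=
  ((k : ℕ) : ℚ)⁻¹ • (a k - ∑ d ∈ (k : ℕ).properDivisors.attach,
    ((d : ℕ) : A) * ghostInv a (d : ℕ).toPNat' ^ ((k : ℕ) / d))
termination_by k
decreasing_by exact toPNat'_lt_of_mem_properDivisors d.2

theorem ghost_ghostInv (a : ℕ+ → A) (k : ℕ+) : ghost (ghostInv a) k = a k := by
  have hk : ((k : ℕ) : ℚ) ≠ 0 := by exact_mod_cast k.ne_zero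
  rw [ghost_eq_sum_properDivisors_add]
  conv_lhs => enter [2, 2]; rw [ghostInv]
  rw [Finset.sum_attach (k : ℕ).properDivisors
    (fun d => (d : A) * ghostInv a d.toPNat' ^ ((k : ℕ) / d)), ← nsmul_eq_mul,
    ← Nat.cast_smul_eq_nsmul ℚ, smul_inv_smul₀ hk, add_sub_cancel]

end Ghost

section BQRepresentation

open MvPolynomial

/-- The polynomial in the ghost variables whose ghost components are the variables. -/
def ghostVar : ℕ+ → MvPolynomial ℕ+ ℚ := ghostInv X

/-- The operator representing `w_k(y)` on polynomials in the ghost variables. -/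
def ghostYOp (k : ℕ+) : Module.End ℚ (MvPolynomial (ℕ+ ⊕ ℕ+) ℚ) :=
  Algebra.lmul ℚ _ (X (Sum.inr k)) + (k : ℕ) • (pderiv (R := ℚ) (Sum.inl k)).toLinearMap

theorem ghostYOp_apply (k : ℕ+) (f : MvPolynomial (ℕ+ ⊕ ℕ+) ℚ) :
    ghostYOp k f = X (Sum.inr k) * f + (k : ℕ) • pderiv (Sum.inl k) f := by
  simp [ghostYOp]

theorem pderiv_pderiv_comm {R σ : Type*} [CommRing R] (i j : σ) (f : MvPolynomial σ R) :
    pderiv i (pderiv j f) = pderiv j (pderiv i f) := by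
  classical
  have : ⁅pderiv (R := R) (σ := σ) i, pderiv (R := R) j⁆ = 0 := by
    refine derivation_ext fun k => ?_
    rw [Derivation.commutator_apply, pderiv_X, pderiv_X, Pi.single_apply, Pi.single_apply]
    split_ifs <;> simp
  rw [← sub_eq_zero, ← Derivation.commutator_apply, this, Derivation.zero_apply]

theorem ghostYOp_comm (k l : ℕ+) : ghostYOp k * ghostYOp l = ghostYOp l * ghostYOp k := by
  refine LinearMap.ext fun f => ?_
  simp only [Module.End.mul_apply, ghostYOp_apply, map_add, pderiv_mul, map_nsmul,
    pderiv_X_of_ne (Sum.inr_ne_inl), pderiv_pderiv_comm (Sum.inl k) (Sum.inl l), smul_add,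
    zero_mul, zero_add, smul_comm (k : ℕ) (l : ℕ),
    mul_left_comm (X (Sum.inr k)) (X (Sum.inr l))]
  abel

theorem ghostYOp_lmul (k l : ℕ+) :
    ghostYOp l * Algebra.lmul ℚ _ (X (Sum.inl k)) = Algebra.lmul ℚ _ (X (Sum.inl k)) * ghostYOp l
      + if k = l then ((k : ℕ) : Module.End ℚ (MvPolynomial (ℕ+ ⊕ ℕ+) ℚ)) else 0 := by
  classical
  refine LinearMap.ext fun f => ?_
  simp only [Module.End.mul_apply, ghostYOp_apply, LinearMap.add_apply, Algebra.coe_lmul_eq_mul,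
    LinearMap.mul_apply', pderiv_mul, pderiv_X, Pi.single_apply, Sum.inl.injEq]
  split_ifs with h
  · subst h
    simp only [Module.End.natCast_apply, nsmul_eq_mul]
    ring
  · simp only [LinearMap.zero_apply, nsmul_eq_mul]
    ring

theorem commEval_ghostYOp_rename (g h : MvPolynomial ℕ+ ℚ) :
    commEval ghostYOp ghostYOp_comm g (rename Sum.inr h) = rename Sum.inr (g * h) := by
  induction g using MvPolynomial.induction_on generalizing h with
  | C a => 
    rw [← algebraMap_eq, AlgHom.commutes, Module.algebraMap_end_apply, ← Algebra.smul_def, map_smul]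
  | add p q hp hq => rw [map_add, LinearMap.add_apply, hp, hq, add_mul, map_add]
  | mul_X p k hp =>
    have h0 : pderiv (Sum.inl k) (rename Sum.inr h : MvPolynomial (ℕ+ ⊕ ℕ+) ℚ) = 0 := by
      refine pderiv_eq_zero_of_notMem_vars fun hk => ?_
      classical
      obtain ⟨_, _, h⟩ := Finset.mem_image.1 (vars_rename _ _ hk)
      exact Sum.inr_ne_inl h
    rw [map_mul, Module.End.mul_apply, commEval_X, ghostYOp_apply, h0, smul_zero, add_zero,
      ← rename_X, ← map_mul, hp, mul_assoc]

/-- The representation of `B(ℚ)` on polynomials in the ghost variables. -/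
def bqRep : BQ →ₐ[ℚ] Module.End ℚ (MvPolynomial (ℕ+ ⊕ ℕ+) ℚ) :=
  RingQuot.liftAlgHom ℚ ⟨FreeAlgebra.lift ℚ (Sum.elim
    (fun d => Algebra.lmul ℚ _ (rename Sum.inl (ghostVar d)))
    (fun e => commEval ghostYOp ghostYOp_comm (ghostVar e))), by
    set F := FreeAlgebra.lift ℚ (Sum.elim
      (fun d => Algebra.lmul ℚ _ (rename Sum.inl (ghostVar d)))
      (fun e => commEval ghostYOp ghostYOp_comm (ghostVar e))) with hF
    have hX : ∀ k, F (ghost bXf k) = Algebra.lmul ℚ _ (X (Sum.inl k)) := by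
      intro k
      have h1 := map_ghost F bXf k
      have h2 := map_ghost ((Algebra.lmul ℚ _).comp (rename Sum.inl) :
        MvPolynomial ℕ+ ℚ →ₐ[ℚ] Module.End ℚ (MvPolynomial (ℕ+ ⊕ ℕ+) ℚ)) ghostVar k
      rw [ghostVar, ghost_ghostInv, ← ghostVar] at h2
      simp only [AlgHom.comp_apply, rename_X] at h2
      rw [h1, h2]
      congr 1
      ext1 d
      simp [hF, bXf]
    have hY : ∀ k, F (ghost bYf k) = ghostYOp k := by
      intro k
      have h1 := map_ghost F bYf k
      have h2 := map_ghost (commEval (R := ℚ) ghostYOp ghostYOp_comm) ghostVar k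
      rw [ghostVar, ghost_ghostInv, ← ghostVar] at h2
      simp only [commEval_X] at h2
      rw [h1, h2]
      congr 1
      ext1 d
      simp [hF, bYf]
    rintro _ _ (⟨k, l⟩ | ⟨k, l⟩ | ⟨k, l⟩)
    · rw [map_mul, map_mul, hX, hX, ← map_mul, ← map_mul, mul_comm]
    · rw [map_mul, map_mul, hY, hY, ghostYOp_comm]
    · rw [map_mul, map_add, map_mul, hX, hY, ghostYOp_lmul]
      split_ifs <;> simp⟩

theorem bqRep_bx (d : ℕ+) : bqRep (bx d) = Algebra.lmul ℚ _ (rename Sum.inl (ghostVar d)) := by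
  simp [bqRep, bx, bXf]

theorem bqRep_by' (e : ℕ+) :
    bqRep (by' e) = commEval ghostYOp ghostYOp_comm (ghostVar e) := by
  simp [bqRep, by', bYf]

end BQRepresentation

section BQBasis

open MvPolynomial

theorem ghost_bx (k : ℕ+) : ghost bx k = RingQuot.mkAlgHom ℚ BRel (ghost bXf k) :=
  (map_ghost (RingQuot.mkAlgHom ℚ BRel) bXf k).symm

theorem ghost_by' (k : ℕ+) : ghost by' k = RingQuot.mkAlgHom ℚ BRel (ghost bYf k) :=
  (map_ghost (RingQuot.mkAlgHom ℚ BRel) bYf k).symm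

theorem ghost_by'_mul_ghost_bx (k l : ℕ+) :
    ghost by' l * ghost bx k = ghost bx k * ghost by' l + if k = l then ((k : ℕ) : BQ) else 0 := by
  rw [ghost_bx, ghost_by', ← map_mul, RingQuot.mkAlgHom_rel ℚ (BRel.yx k l), map_add, map_mul]
  split_ifs <;> simp

theorem bx_comm (k l : ℕ+) : bx k * bx l = bx l * bx k := by
  have h : ∀ k l, Commute (ghost bx k) (ghost bx l) := fun k l => by
    rw [ghost_bx, ghost_bx, Commute, SemiconjBy, ← map_mul, ← map_mul,
      RingQuot.mkAlgHom_rel ℚ (BRel.xx k l)]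
  exact commute_of_commute_ghost
    (fun l => (commute_of_commute_ghost (fun k => h l k) k).symm) l

theorem by'_comm (k l : ℕ+) : by' k * by' l = by' l * by' k := by
  have h : ∀ k l, Commute (ghost by' k) (ghost by' l) := fun k l => by
    rw [ghost_by', ghost_by', Commute, SemiconjBy, ← map_mul, ← map_mul,
      RingQuot.mkAlgHom_rel ℚ (BRel.yy k l)]
  exact commute_of_commute_ghost
    (fun l => (commute_of_commute_ghost (fun k => h l k) k).symm) l

/-- Substitution of the ghost components for the ghost variables. -/
def ghostSubst : MvPolynomial (ℕ+ ⊕ ℕ+) ℚ →ₐ[ℚ] MvPolynomial (ℕ+ ⊕ ℕ+) ℚ :=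
  aeval (Sum.elim (ghost fun d => X (Sum.inl d)) (ghost fun d => X (Sum.inr d)))

theorem ghostSubst_rename_inl (d : ℕ+) :
    ghostSubst (rename Sum.inl (ghostVar d)) = X (Sum.inl d) := by
  refine ghost_injective (g := fun d => ghostSubst (rename Sum.inl (ghostVar d)))
    (h := fun d => X (Sum.inl d)) (fun k => ?_) d
  have h := map_ghost (ghostSubst.comp (rename Sum.inl)) ghostVar k
  rw [ghostVar, ghost_ghostInv, ← ghostVar] at h
  simpa [ghostSubst] using h.symm

theorem ghostSubst_rename_inr (d : ℕ+) :
    ghostSubst (rename Sum.inr (ghostVar d)) = X (Sum.inr d) := by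
  refine ghost_injective (g := fun d => ghostSubst (rename Sum.inr (ghostVar d)))
    (h := fun d => X (Sum.inr d)) (fun k => ?_) d
  have h := map_ghost (ghostSubst.comp (rename Sum.inr)) ghostVar k
  rw [ghostVar, ghost_ghostInv, ← ghostVar] at h
  simpa [ghostSubst] using h.symm

variable {ι κ : Type*} (a : ι → ℕ+) (b : κ → ℕ+)

theorem bqRep_commEval_bx (f : MvPolynomial ι ℤ) :
    bqRep (commEval (fun i => bx (a i)) (fun _ _ => bx_comm _ _) f) =
      Algebra.lmul ℚ _ (aeval (fun i => rename Sum.inl (ghostVar (a i))) f) := by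
  have : (bqRep.restrictScalars ℤ).comp
      (commEval (fun i => bx (a i)) (fun _ _ => bx_comm _ _)) =
      ((Algebra.lmul ℚ _).restrictScalars ℤ).comp
        (aeval fun i => rename Sum.inl (ghostVar (a i))) :=
    algHom_ext fun i => by simp [bqRep_bx]
  exact DFunLike.congr_fun this f

theorem bqRep_commEval_by' (g : MvPolynomial κ ℤ) :
    bqRep (commEval (fun j => by' (b j)) (fun _ _ => by'_comm _ _) g) =
      commEval ghostYOp ghostYOp_comm (aeval (fun j => ghostVar (b j)) g) := by
  have : (bqRep.restrictScalars ℤ).comp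
      (commEval (fun j => by' (b j)) (fun _ _ => by'_comm _ _)) =
      ((commEval (R := ℚ) ghostYOp ghostYOp_comm).restrictScalars ℤ).comp
        (aeval fun j => ghostVar (b j)) :=
    algHom_ext fun i => by simp [bqRep_by']
  exact DFunLike.congr_fun this g

open TensorProduct in
theorem ghostSubst_bqRep_normalForm (T : MvPolynomial ι ℤ ⊗[ℤ] MvPolynomial κ ℤ) :
    ghostSubst (bqRep (normalForm (fun i => bx (a i)) (fun j => by' (b j))
      (fun _ _ => bx_comm _ _) (fun _ _ => by'_comm _ _) T) 1) =
      aeval (fun v => (X (Sum.map a b v) : MvPolynomial (ℕ+ ⊕ ℕ+) ℚ))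
        (tensorEquivSum ℤ ι κ ℤ T) := by
  set M : MvPolynomial (ι ⊕ κ) ℤ →ₐ[ℤ] MvPolynomial (ℕ+ ⊕ ℕ+) ℚ :=
    aeval fun v => X (Sum.map a b v) with hM
  induction T with
  | zero => simp
  | add S T hS hT => simp only [map_add, LinearMap.add_apply, hS, hT]
  | tmul f g =>
    have hf : (ghostSubst.restrictScalars ℤ).comp
        (aeval fun i => rename Sum.inl (ghostVar (a i))) =
        M.comp ((tensorEquivSum ℤ ι κ ℤ).toAlgHom.comp Algebra.TensorProduct.includeLeft) :=
      algHom_ext fun i => by simp [hM, ghostSubst_rename_inl]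
    have hg : ((ghostSubst.restrictScalars ℤ).comp ((rename Sum.inr).restrictScalars ℤ)).comp
        (aeval fun j => ghostVar (b j)) =
        M.comp ((tensorEquivSum ℤ ι κ ℤ).toAlgHom.comp Algebra.TensorProduct.includeRight) :=
      algHom_ext fun i => by simp [hM, ghostSubst_rename_inr]
    replace hf := DFunLike.congr_fun hf f
    replace hg := DFunLike.congr_fun hg g
    have hfg : tensorEquivSum ℤ ι κ ℤ (f ⊗ₜ[ℤ] g) =
        tensorEquivSum ℤ ι κ ℤ (f ⊗ₜ 1) * tensorEquivSum ℤ ι κ ℤ (1 ⊗ₜ g) := by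
      rw [← map_mul, Algebra.TensorProduct.tmul_mul_tmul, mul_one, one_mul]
    rw [normalForm_tmul, map_mul, Module.End.mul_apply, bqRep_commEval_bx, bqRep_commEval_by',
      ← map_one (rename Sum.inr : MvPolynomial ℕ+ ℚ →ₐ[ℚ] _), commEval_ghostYOp_rename, mul_one,
      hfg, map_mul]
    simp only [Algebra.coe_lmul_eq_mul, LinearMap.mul_apply', map_mul]
    exact congrArg₂ (· * ·) hf hg

theorem normalForm_bx_by'_injective (ha : Function.Injective a) (hb : Function.Injective b) :
    Function.Injective (normalForm (R := ℤ) (fun i => bx (a i)) (fun j => by' (b j))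
      (fun _ _ => bx_comm _ _) (fun _ _ => by'_comm _ _)) := by
  intro S T h
  have := congrArg (fun z => ghostSubst (bqRep z 1)) h
  simp only [ghostSubst_bqRep_normalForm] at this
  refine (tensorEquivSum ℤ ι κ ℤ).injective (rename_injective _ (ha.sumMap hb)
    (map_injective (Int.castRingHom ℚ) Int.cast_injective ?_))
  have hM : ∀ f : MvPolynomial (ι ⊕ κ) ℤ, map (Int.castRingHom ℚ) (rename (Sum.map a b) f) =
      aeval (fun v => (X (Sum.map a b v) : MvPolynomial (ℕ+ ⊕ ℕ+) ℚ)) f := fun f => by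
    induction f using MvPolynomial.induction_on with
    | C r => simp
    | add f g hf hg => simp only [map_add, hf, hg]
    | mul_X f v hf => simp only [map_mul, hf, rename_X, map_X, aeval_X]
  rw [hM, hM, this]

end BQBasis

section PTypical

variable {p : ℕ}

theorem coe_ppow (hp : p.Prime) (i : ℕ) : (ppow p i : ℕ) = p ^ i :=
  PNat.toPNat'_coe (pow_pos hp.pos i)

theorem ppow_injective (hp : p.Prime) : Function.Injective (ppow p) := fun i j h => by
  have := congrArg PNat.val h
  rw [coe_ppow hp, coe_ppow hp] at this
  exact Nat.pow_right_injective hp.two_le this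

theorem pGhost_ppow (hp : p.Prime) {A : Type*} [Ring A] (g : ℕ+ → A) (n : ℕ) :
    pGhost p (fun i => g (ppow p i)) n = ghost g (ppow p n) := by
  rw [ghost_eq_sum_divisors, coe_ppow hp, Nat.divisors_prime_pow hp, Finset.sum_map, pGhost]
  refine Finset.sum_congr rfl fun s hs => ?_
  have hs : s ≤ n := Nat.lt_succ_iff.1 (Finset.mem_range.1 hs)
  simp [ppow, Nat.pow_div hs hp.pos]

theorem commute_pGhost_bx_by' (hp : p.Prime) {k l : ℕ} (h : l ≠ k) :
    Commute (pGhost p (fun j => by' (ppow p j)) l) (pGhost p (fun i => bx (ppow p i)) k) := by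
  rw [pGhost_ppow hp, pGhost_ppow hp, Commute, SemiconjBy, ghost_by'_mul_ghost_bx,
    if_neg fun h' => h (ppow_injective hp h').symm, add_zero]

theorem pGhost_bx_by' (hp : p.Prime) (k : ℕ) :
    pGhost p (fun j => by' (ppow p j)) k * pGhost p (fun i => bx (ppow p i)) k -
      pGhost p (fun i => bx (ppow p i)) k * pGhost p (fun j => by' (ppow p j)) k =
        (p : BQ) ^ k := by
  rw [pGhost_ppow hp, pGhost_ppow hp, ghost_by'_mul_ghost_bx, if_pos rfl, add_sub_cancel_left,
    coe_ppow hp, Nat.cast_pow]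

theorem eq_zero_of_prime_mul_eq_zero (hp : p.Prime) {A : Type*} [Ring A] [Algebra ℚ A] (z : A)
    (h : (p : A) * z = 0) : z = 0 :=
  natCast_mul_injective_of_rat ⟨p, hp.pos⟩ (h.trans (mul_zero _).symm)

end PTypical

section Evaluation

variable {A A' F : Type*} [Ring A] [Ring A'] [FunLike F A A'] [RingHomClass F A A']

theorem map_cEval (f : F) (x y : ℕ+ → A) (q : MvPolynomial (ℕ+ ⊕ₗ ℕ+) ℤ) :
    f (cEval x y q) = cEval (fun d => f (x d)) (fun e => f (y e)) q := by
  rw [cEval, cEval, pEval, pEval, map_sum]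
  refine Finset.sum_congr rfl fun e _ => ?_
  rw [map_zsmul, ordProd, ordProd, map_list_prod, List.map_map]
  congr 2
  refine List.map_congr_left fun v _ => ?_
  rw [Function.comp_apply, map_pow]
  congr 1
  rcases ofLex v with d | d <;> rfl

theorem cEval_mem (S : Subalgebra ℤ A) {x y : ℕ+ → A} {q : MvPolynomial (ℕ+ ⊕ₗ ℕ+) ℤ}
    (h : ∀ v ∈ q.vars, Sum.elim x y (ofLex v) ∈ S) : cEval x y q ∈ S := by
  refine sum_mem fun e he => S.smul_mem (list_prod_mem fun a ha => ?_) _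
  obtain ⟨v, hv, rfl⟩ := List.mem_map.1 ha
  exact pow_mem (h v ((MvPolynomial.mem_vars_iff_mem_support v).2 ⟨e, he, by simpa using hv⟩)) _

end Evaluation

section NormalFormMaps

open MvPolynomial TensorProduct

variable {R B B' ι κ ι' κ' : Type*} [CommRing R] [Ring B] [Algebra R B] [Ring B'] [Algebra R B']

theorem map_normalForm (f : B →ₐ[R] B') {x : ι → B} {y : κ → B} {x' : ι' → B'} {y' : κ' → B'}
    (hx : ∀ i j, x i * x j = x j * x i) (hy : ∀ i j, y i * y j = y j * y i)
    (hx' : ∀ i j, x' i * x' j = x' j * x' i) (hy' : ∀ i j, y' i * y' j = y' j * y' i)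
    {a : ι → ι'} {b : κ → κ'} (hxx' : ∀ i, f (x i) = x' (a i)) (hyy' : ∀ j, f (y j) = y' (b j))
    (T : MvPolynomial ι R ⊗[R] MvPolynomial κ R) :
    f (normalForm x y hx hy T) = normalForm x' y' hx' hy'
      (TensorProduct.map (rename a).toLinearMap (rename b).toLinearMap T) := by
  have h1 : f.comp (commEval x hx) = (commEval x' hx').comp (rename a) :=
    algHom_ext fun i => by simp [hxx']
  have h2 : f.comp (commEval y hy) = (commEval y' hy').comp (rename b) :=
    algHom_ext fun i => by simp [hyy']
  induction T with
  | zero => simp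
  | add S T hS hT => simp only [map_add, hS, hT]
  | tmul g h =>
    have h1 := DFunLike.congr_fun h1 g
    have h2 := DFunLike.congr_fun h2 h
    simp only [AlgHom.comp_apply] at h1 h2
    simp [h1, h2]

end NormalFormMaps

section Transfer

open MvPolynomial TensorProduct

variable {p : ℕ} (hp : p.Prime) {R : Type*} [CommRing R] {m n : ℕ}
  {c : ℕ+ → ℕ+ → MvPolynomial (ℕ+ ⊕ₗ ℕ+) ℤ} (hc : IsCFamily c) {C : Type*} [Ring C] [Algebra R C]
  (π : Bmn R p c m n →ₐ[R] C)

theorem gx_comm (i j : Fin m) :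
    gx R p c m n i * gx R p c m n j = gx R p c m n j * gx R p c m n i := by
  rw [gx, gx, ← map_mul, ← map_mul, RingQuot.mkAlgHom_rel R (BmnRel.xx i j)]

theorem gy_comm (i j : Fin n) :
    gy R p c m n i * gy R p c m n j = gy R p c m n j * gy R p c m n i := by
  rw [gy, gy, ← map_mul, ← map_mul, RingQuot.mkAlgHom_rel R (BmnRel.yy i j)]

/-- The generator `x_i` of `B(ℚ) × C`. -/
def prodX (i : Fin m) : BQ × C := (bx (ppow p i), π (gx R p c m n i))

/-- The generator `y_j` of `B(ℚ) × C`. -/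
def prodY (j : Fin n) : BQ × C := (by' (ppow p j), π (gy R p c m n j))

theorem prodX_comm (i j : Fin m) : prodX π i * prodX π j = prodX π j * prodX π i :=
  Prod.ext (bx_comm _ _) (by simp only [prodX, Prod.snd_mul, ← map_mul, gx_comm i j])

theorem prodY_comm (i j : Fin n) : prodY π i * prodY π j = prodY π j * prodY π i :=
  Prod.ext (by'_comm _ _) (by simp only [prodY, Prod.snd_mul, ← map_mul, gy_comm i j])

include hp

theorem exists_eq_ppow_of_dvd {d : ℕ+} {i : ℕ} (hd : (d : ℕ) ∣ (ppow p i : ℕ))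
    (hne : d ≠ ppow p i) : ∃ r < i, d = ppow p r ∧ padicValNat p (d : ℕ) = r := by
  have := Fact.mk hp
  rw [coe_ppow hp, Nat.dvd_prime_pow hp] at hd
  obtain ⟨r, hr, hdr⟩ := hd
  have hdr' : d = ppow p r := PNat.eq (hdr.trans (coe_ppow hp r).symm)
  refine ⟨r, lt_of_le_of_ne hr fun h => hne (h ▸ hdr'), hdr', ?_⟩
  rw [hdr, padicValNat.prime_pow]

include hc

theorem prodY_mul_prodX_sub_mem (i : Fin m) (j : Fin n) :
    prodY π j * prodX π i - prodX π i * prodY π j ∈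
      Algebra.adjoin ℤ (Set.range (prodX π) ∪ prodY π '' {k | k < j}) := by
  set q : FreeAlgebra R (Fin m ⊕ Fin n) →ₐ[R] C := π.comp (RingQuot.mkAlgHom R (BmnRel R p c m n))
  set xt : ℕ+ → BQ × C := fun d => (bx d, q (sxm R p m n d))
  set yt : ℕ+ → BQ × C := fun e => (by' e, q (syn R p m n e))
  have h : prodY π j * prodX π i - prodX π i * prodY π j =
      cEval xt yt (c (ppow p i) (ppow p j)) := by
    refine Prod.ext ?_ ?_
    · exact (hc _ _).2.symm.trans (map_cEval (RingHom.fst BQ C) xt yt _).symm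
    · refine Eq.trans ?_ (map_cEval (RingHom.snd BQ C) xt yt _).symm
      refine Eq.trans ?_ (map_cEval q _ _ _)
      have hrel := congrArg π (RingQuot.mkAlgHom_rel R (BmnRel.yx (R := R) (p := p) (c := c) i j))
      rw [map_add, map_add, ← sub_eq_iff_eq_add'] at hrel
      simpa [prodX, prodY, gx, gy, q] using hrel
  rw [h]
  refine cEval_mem _ fun v hv => Algebra.subset_adjoin ?_
  rcases (hc _ _).1 v hv with ⟨d, hd, hne, hv⟩ | ⟨d, hd, hne, hv⟩
  · obtain ⟨r, hr, hdr, hval⟩ := exists_eq_ppow_of_dvd hp hd hne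
    refine Or.inl ⟨⟨r, hr.trans i.2⟩, ?_⟩
    rw [hv, Sum.elim_inl]
    refine Prod.ext (congrArg bx hdr.symm) ?_
    subst hval
    simp [prodX, gx, xt, q, sxm, hr.trans i.2]
  · obtain ⟨r, hr, hdr, hval⟩ := exists_eq_ppow_of_dvd hp hd hne
    refine Or.inr ⟨⟨r, hr.trans j.2⟩, hr, ?_⟩
    rw [hv, Sum.elim_inr]
    refine Prod.ext (congrArg by' hdr.symm) ?_
    subst hval
    simp [prodY, gy, yt, q, syn, hr.trans j.2]

omit [Algebra R C] in
theorem by'_mul_bx_sub_mem (i j : ℕ) :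
    by' (ppow p j) * bx (ppow p i) - bx (ppow p i) * by' (ppow p j) ∈
      Algebra.adjoin ℤ (Set.range (fun i => bx (ppow p i)) ∪
        (fun j => by' (ppow p j)) '' {k | k < j}) := by
  rw [← (hc _ _).2]
  refine cEval_mem _ fun v hv => Algebra.subset_adjoin ?_
  rcases (hc _ _).1 v hv with ⟨d, hd, hne, hv⟩ | ⟨d, hd, hne, hv⟩
  · obtain ⟨r, hr, hdr, -⟩ := exists_eq_ppow_of_dvd hp hd hne
    exact Or.inl ⟨r, by rw [hv, hdr]; rfl⟩
  · obtain ⟨r, hr, hdr, -⟩ := exists_eq_ppow_of_dvd hp hd hne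
    exact Or.inr ⟨r, hr, by rw [hv, hdr]; rfl⟩

/-- An element of the `ℤ`-algebra generated by the diagonal generators of `B(ℚ) × C` whose first
component is divisible by `p` in the integral form of `B(ℚ)` has zero second component. -/
theorem snd_eq_zero_of_fst_eq_mul (hpC : (p : C) = 0) {u : BQ × C}
    (hu : u ∈ Algebra.adjoin ℤ (Set.range (prodX π) ∪ Set.range (prodY π))) {v : BQ}
    (hv : v ∈ Algebra.adjoin ℤ
      (Set.range (fun i => bx (ppow p i)) ∪ Set.range (fun j => by' (ppow p j))))
    (huv : u.1 = (p : BQ) * v) : u.2 = 0 := by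
  obtain ⟨T, rfl⟩ := adjoin_le_range_normalForm (prodX π) (prodY π) (prodX_comm π) (prodY_comm π)
    (prodY_mul_prodX_sub_mem hp hc π) hu
  obtain ⟨S, rfl⟩ := adjoin_le_range_normalForm (R := ℤ) (fun i => bx (ppow p i))
    (fun j => by' (ppow p j)) (fun _ _ => bx_comm _ _) (fun _ _ => by'_comm _ _)
    (by'_mul_bx_sub_mem hp hc) hv
  have h1 := map_normalForm (AlgHom.fst ℤ BQ C) (prodX_comm π) (prodY_comm π)
    (x' := fun i => bx (ppow p i)) (y' := fun j => by' (ppow p j))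
    (fun _ _ => bx_comm _ _) (fun _ _ => by'_comm _ _) (a := Fin.val) (b := Fin.val)
    (fun _ => rfl) (fun _ => rfl) T
  rw [AlgHom.fst_apply, huv, ← nsmul_eq_mul, ← map_nsmul] at h1
  have h2 := normalForm_bx_by'_injective (ppow p) (ppow p) (ppow_injective hp)
    (ppow_injective hp) h1
  set ρ := TensorProduct.map (killCompl (R := ℤ) (Fin.val_injective (n := m))).toLinearMap
    (killCompl (R := ℤ) (Fin.val_injective (n := n))).toLinearMap with hρ
  have h3 : T = p • ρ S := by
    rw [← map_nsmul, h2, hρ, ← LinearMap.comp_apply, ← TensorProduct.map_comp,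
      ← AlgHom.comp_toLinearMap, ← AlgHom.comp_toLinearMap, killCompl_comp_rename,
      killCompl_comp_rename]
    simp
  rw [h3, map_nsmul, Prod.smul_snd, nsmul_eq_mul, hpC, zero_mul]

variable (hpC : (p : C) = 0)
include hpC

theorem commute_gy_gx_pow {k : ℕ} (j : Fin m) (l : Fin n) (h : (l : ℕ) < k) :
    Commute (π (gy R p c m n l)) (π (gx R p c m n j) ^ p ^ k) := by
  have := Fact.mk hp
  obtain ⟨v, hv, huv⟩ := exists_comm_pow_eq_mul p (fun i => bx (ppow p i))
    (fun j => by' (ppow p j)) (fun _ _ => bx_comm _ _)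
    (fun z => eq_zero_of_prime_mul_eq_zero hp z) (fun _ _ => commute_pGhost_bx_by' hp) h j
  have hX : prodX π j ∈ Algebra.adjoin ℤ (Set.range (prodX π) ∪ Set.range (prodY π)) :=
    Algebra.subset_adjoin (Or.inl ⟨j, rfl⟩)
  have hY : prodY π l ∈ Algebra.adjoin ℤ (Set.range (prodX π) ∪ Set.range (prodY π)) :=
    Algebra.subset_adjoin (Or.inr ⟨l, rfl⟩)
  exact sub_eq_zero.1 (snd_eq_zero_of_fst_eq_mul hp hc π hpC
    (u := prodY π l * prodX π j ^ p ^ k - prodX π j ^ p ^ k * prodY π l)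
    (sub_mem (mul_mem hY (pow_mem hX _)) (mul_mem (pow_mem hX _) hY)) hv huv)

theorem commute_gx_gy_pow {k : ℕ} (j : Fin n) (l : Fin m) (h : (l : ℕ) < k) :
    Commute (π (gx R p c m n l)) (π (gy R p c m n j) ^ p ^ k) := by
  have := Fact.mk hp
  obtain ⟨v, hv, huv⟩ := exists_comm_pow_eq_mul p (fun j => by' (ppow p j))
    (fun i => bx (ppow p i)) (fun _ _ => by'_comm _ _)
    (fun z => eq_zero_of_prime_mul_eq_zero hp z)
    (fun _ _ h => (commute_pGhost_bx_by' hp h.symm).symm) h j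
  rw [Set.union_comm] at hv
  have hX : prodX π l ∈ Algebra.adjoin ℤ (Set.range (prodX π) ∪ Set.range (prodY π)) :=
    Algebra.subset_adjoin (Or.inl ⟨l, rfl⟩)
  have hY : prodY π j ∈ Algebra.adjoin ℤ (Set.range (prodX π) ∪ Set.range (prodY π)) :=
    Algebra.subset_adjoin (Or.inr ⟨j, rfl⟩)
  exact sub_eq_zero.1 (snd_eq_zero_of_fst_eq_mul hp hc π hpC
    (u := prodX π l * prodY π j ^ p ^ k - prodY π j ^ p ^ k * prodX π l)
    (sub_mem (mul_mem hX (pow_mem hY _)) (mul_mem (pow_mem hY _) hX)) hv huv)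

theorem gy_pow_mul_gx_pow (j : Fin m) (k : Fin n) :
    π (gy R p c m n k) ^ p ^ (j : ℕ) * π (gx R p c m n j) ^ p ^ (k : ℕ) =
      π (gx R p c m n j) ^ p ^ (k : ℕ) * π (gy R p c m n k) ^ p ^ (j : ℕ) + 1 := by
  have := Fact.mk hp
  obtain ⟨v, hv, huv⟩ := exists_comm_pow_pow_eq_one_add p (fun i => bx (ppow p i))
    (fun j => by' (ppow p j)) (fun _ _ => bx_comm _ _)
    (fun z => eq_zero_of_prime_mul_eq_zero hp z) (fun _ _ => commute_pGhost_bx_by' hp)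
    (pGhost_bx_by' hp) j k
  have hX : prodX π j ∈ Algebra.adjoin ℤ (Set.range (prodX π) ∪ Set.range (prodY π)) :=
    Algebra.subset_adjoin (Or.inl ⟨j, rfl⟩)
  have hY : prodY π k ∈ Algebra.adjoin ℤ (Set.range (prodX π) ∪ Set.range (prodY π)) :=
    Algebra.subset_adjoin (Or.inr ⟨k, rfl⟩)
  have h := snd_eq_zero_of_fst_eq_mul hp hc π hpC
    (u := prodY π k ^ p ^ (j : ℕ) * prodX π j ^ p ^ (k : ℕ) -
      prodX π j ^ p ^ (k : ℕ) * prodY π k ^ p ^ (j : ℕ) - 1)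
    (sub_mem (sub_mem (mul_mem (pow_mem hY _) (pow_mem hX _))
      (mul_mem (pow_mem hX _) (pow_mem hY _))) (one_mem _)) hv huv
  exact sub_eq_iff_eq_add'.1 (sub_eq_zero.1 h)

end Transfer

section OpClosure

variable {R V ι : Type*} [CommRing R] [AddCommGroup V] [Module R V]

/-- The smallest submodule containing `N` and stable under the operators in `S`. -/
def opClosure (S : Set (Module.End R V)) (N : Submodule R V) : Submodule R V :=
  sInf {M | N ≤ M ∧ ∀ s ∈ S, ∀ v ∈ M, s v ∈ M}

theorem le_opClosure (S : Set (Module.End R V)) (N : Submodule R V) : N ≤ opClosure S N :=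
  le_sInf fun _ hM => hM.1

theorem opClosure_le {S : Set (Module.End R V)} {N M : Submodule R V} (hN : N ≤ M)
    (hS : ∀ s ∈ S, ∀ v ∈ M, s v ∈ M) : opClosure S N ≤ M :=
  sInf_le ⟨hN, hS⟩

theorem apply_mem_opClosure {S : Set (Module.End R V)} {N : Submodule R V} {s : Module.End R V}
    (hs : s ∈ S) {v : V} (hv : v ∈ opClosure S N) : s v ∈ opClosure S N := by
  rw [opClosure, Submodule.mem_sInf] at hv ⊢
  exact fun M hM => hM.2 s hs v (hv M hM)

theorem apply_mem_opClosure_of_commute {S : Set (Module.End R V)} {N : Submodule R V}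
    {u : Module.End R V} (hu : ∀ s ∈ S, Commute u s) (hN : ∀ v ∈ N, u v ∈ opClosure S N) {v : V}
    (hv : v ∈ opClosure S N) : u v ∈ opClosure S N := by
  refine opClosure_le (M := (opClosure S N).comap u) hN (fun s hs w hw => ?_) hv
  rw [Submodule.mem_comap] at hw ⊢
  rw [← Module.End.mul_apply, (hu s hs).eq]
  exact apply_mem_opClosure hs hw

theorem map_eq_zero_of_mem_opClosure {S : Set (Module.End R V)} {N : Submodule R V}
    {u : Module.End R V} (hu : ∀ s ∈ S, Commute u s) (hN : ∀ v ∈ N, u v = 0) {v : V}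
    (hv : v ∈ opClosure S N) : u v = 0 := by
  refine opClosure_le (M := LinearMap.ker u) hN (fun s hs w hw => ?_) hv
  rw [LinearMap.mem_ker] at hw ⊢
  rw [← Module.End.mul_apply, (hu s hs).eq, Module.End.mul_apply, hw, map_zero]

theorem opClosure_le_opClosure_opClosure {S T : Set (Module.End R V)} {N : Submodule R V}
    (hST : ∀ s ∈ S, ∀ u ∈ T, Commute u s) :
    opClosure (S ∪ T) N ≤ opClosure S (opClosure T N) := by
  refine opClosure_le ((le_opClosure T N).trans (le_opClosure S _)) ?_
  rintro s (hs | hs) v hv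
  · exact apply_mem_opClosure hs hv
  · exact apply_mem_opClosure_of_commute (fun u hu => hST u hu s hs)
      (fun w hw => le_opClosure S _ (apply_mem_opClosure hs hw)) hv

theorem opClosure_opClosure_le {S T : Set (Module.End R V)} {N : Submodule R V} :
    opClosure S (opClosure T N) ≤ opClosure (S ∪ T) N :=
  opClosure_le
    (opClosure_le (le_opClosure _ N) fun _ hs _ hv => apply_mem_opClosure (Or.inr hs) hv)
    fun _ hs _ hv => apply_mem_opClosure (Or.inl hs) hv

theorem pow_apply_pow_apply_of_weyl {E t : Module.End R V} (h : E * t = t * E + 1) {w : V}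
    (hw : E w = 0) (e k : ℕ) :
    (E ^ e) ((t ^ k) w) = k.descFactorial e • (t ^ (k - e)) w := by
  have h1 : ∀ k, E ((t ^ k) w) = k • (t ^ (k - 1)) w := by
    intro k
    induction k with
    | zero => simp [hw]
    | succ k ih =>
      rw [pow_succ', Module.End.mul_apply, ← Module.End.mul_apply E, h, LinearMap.add_apply,
        Module.End.mul_apply, ih, Module.End.one_apply, Nat.add_sub_cancel, succ_nsmul, map_nsmul,
        ← Module.End.mul_apply, ← pow_succ']
      rcases k with _ | k
      · simp
      · rfl
  induction e with
  | zero => simp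
  | succ e ih =>
    rw [pow_succ', Module.End.mul_apply, ih, map_nsmul, h1, smul_smul, Nat.descFactorial_succ,
      mul_comm, Nat.sub_sub]

variable {p : ℕ} (hp : p.Prime) (hpV : ∀ v : V, p • v = 0)
include hp hpV

theorem eq_zero_of_factorial_nsmul {e : ℕ} (he : e < p) {w : V} (hw : e.factorial • w = 0) :
    w = 0 := by
  have h1 := addOrderOf_dvd_iff_nsmul_eq_zero.2 hw
  have h2 := addOrderOf_dvd_iff_nsmul_eq_zero.2 (hpV w)
  exact AddMonoid.addOrderOf_eq_one_iff.1
    (Nat.eq_one_of_dvd_coprimes (hp.coprime_factorial_of_lt he) h2 h1)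

theorem mem_of_weyl_of_apply_eq_zero {E t : Module.End R V} (h : E * t = t * E + 1)
    {W : Submodule R V} (hW : ∀ w ∈ W, E w = 0) {w : ℕ → V} (hw : ∀ k, w k ∈ W) {d : ℕ}
    (hd : d ≤ p) (hE : E (∑ k ∈ Finset.range d, (t ^ k) (w k)) = 0) :
    ∑ k ∈ Finset.range d, (t ^ k) (w k) ∈ W := by
  induction d with
  | zero => simp
  | succ e ih =>
    rcases Nat.eq_zero_or_pos e with rfl | he
    · simpa using hw 0
    have h0 : (E ^ e) (∑ k ∈ Finset.range (e + 1), (t ^ k) (w k)) = e.factorial • w e := by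
      rw [map_sum, Finset.sum_eq_single_of_mem e (by simp)]
      · rw [pow_apply_pow_apply_of_weyl h (hW _ (hw e)), Nat.descFactorial_self, Nat.sub_self,
          pow_zero, Module.End.one_apply]
      · intro k hk hke
        have hk : k < e := lt_of_le_of_ne (Nat.lt_succ_iff.1 (Finset.mem_range.1 hk)) hke
        rw [pow_apply_pow_apply_of_weyl h (hW _ (hw k)), Nat.descFactorial_of_lt hk, zero_smul]
    have h1 : w e = 0 := by
      refine eq_zero_of_factorial_nsmul hp hpV hd ?_
      obtain ⟨e, rfl⟩ := Nat.exists_eq_succ_of_ne_zero he.ne'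
      rw [← h0, pow_succ, Module.End.mul_apply, hE, map_zero]
    rw [Finset.sum_range_succ, h1, map_zero, add_zero] at hE ⊢
    exact ih (by omega) hE

omit hp hpV in
theorem exists_sum_of_mem_opClosure_insert (hp0 : 0 < p) {S : Set (Module.End R V)}
    {t : Module.End R V} (ht : ∀ s ∈ S, Commute s t) {N : Submodule R V} {v : V}
    (hv : v ∈ opClosure (insert t S) N) :
    ∃ w : ℕ → V, (∀ k, w k ∈ opClosure (insert (t ^ p) S) N) ∧
      v = ∑ k ∈ Finset.range p, (t ^ k) (w k) := by
  set W := opClosure (insert (t ^ p) S) N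
  let M : Submodule R V :=
    { carrier := {v | ∃ w : ℕ → V, (∀ k, w k ∈ W) ∧ v = ∑ k ∈ Finset.range p, (t ^ k) (w k)}
      add_mem' := by
        rintro _ _ ⟨w, hw, rfl⟩ ⟨w', hw', rfl⟩
        exact ⟨fun k => w k + w' k, fun k => W.add_mem (hw k) (hw' k), by
          simp [Finset.sum_add_distrib]⟩
      zero_mem' := ⟨0, fun _ => W.zero_mem, by simp⟩
      smul_mem' := by
        rintro r _ ⟨w, hw, rfl⟩
        exact ⟨fun k => r • w k, fun k => W.smul_mem r (hw k), by simp [Finset.smul_sum]⟩ }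
  refine opClosure_le (M := M) (fun v hv => ?_) ?_ hv
  · refine ⟨Pi.single 0 v, fun k => ?_, ?_⟩
    · rw [Pi.single_apply]
      split_ifs
      · exact le_opClosure _ N hv
      · exact W.zero_mem
    · rw [Finset.sum_eq_single_of_mem 0 (Finset.mem_range.2 hp0)]
      · simp
      · intro k _ hk
        simp [hk]
  · rintro s (rfl | hs) _ ⟨w, hw, rfl⟩
    · obtain ⟨q, rfl⟩ := Nat.exists_eq_succ_of_ne_zero hp0.ne'
      refine ⟨fun k => k.casesOn ((s ^ (q + 1)) (w q)) w, fun k => ?_, ?_⟩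
      · cases k with
        | zero => exact apply_mem_opClosure (Or.inl rfl) (hw q)
        | succ k => exact hw k
      · rw [Finset.sum_range_succ, Finset.sum_range_succ', map_add, map_sum]
        simp [pow_succ']
    · refine ⟨fun k => s (w k), fun k => apply_mem_opClosure (Or.inr hs) (hw k), ?_⟩
      rw [map_sum]
      refine Finset.sum_congr rfl fun k _ => ?_
      rw [← Module.End.mul_apply, ((ht s hs).pow_right k).eq, Module.End.mul_apply]

/-- Let `t` be commuting operators in characteristic `p` and `E` a triangular family of
derivations dual to `t` and killing `N`. The common kernel of `E` in the closure of `N` under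
the `t_i` is contained in the closure of `N` under the `t_i ^ p`. -/
theorem mem_opClosure_pow_of_apply_eq_zero [LinearOrder ι] {t E : ι → Module.End R V}
    (htt : ∀ i j, Commute (t i) (t j)) (hlt : ∀ i j, j < i → Commute (E i) (t j))
    (hEt : ∀ i, E i * t i = t i * E i + 1) (hEp : ∀ i j, Commute (E i) (t j ^ p))
    (s : Finset ι) {N : Submodule R V} (hN : ∀ i, ∀ v ∈ N, E i v = 0) {v : V}
    (hv : v ∈ opClosure (t '' s) N) (hEv : ∀ i ∈ s, E i v = 0) :
    v ∈ opClosure ((fun i => t i ^ p) '' s) N := by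
  induction s using Finset.induction_on_max generalizing N with
  | empty => simpa using hv
  | insert a s ha ih =>
    rw [Finset.coe_insert, Set.image_insert_eq] at hv ⊢
    have hW : ∀ w ∈ opClosure (insert (t a ^ p) (t '' s)) N, E a w = 0 := fun w hw => by
      refine map_eq_zero_of_mem_opClosure ?_ (hN a) hw
      rintro _ (rfl | ⟨j, hj, rfl⟩)
      · exact hEp a a
      · exact hlt a j (ha j hj)
    have hvW : v ∈ opClosure (insert (t a ^ p) (t '' s)) N := by
      obtain ⟨w, hw, rfl⟩ := exists_sum_of_mem_opClosure_insert hp.pos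
        (by rintro _ ⟨j, -, rfl⟩; exact htt j a) hv
      exact mem_of_weyl_of_apply_eq_zero hp hpV (hEt a) hW hw le_rfl
        (hEv a (Finset.mem_insert_self a s))
    rw [Set.insert_eq, Set.union_comm] at hvW ⊢
    refine opClosure_opClosure_le (ih (fun i w hw => ?_) (opClosure_le_opClosure_opClosure ?_ hvW)
      fun i hi => hEv i (Finset.mem_insert_of_mem hi))
    · refine map_eq_zero_of_mem_opClosure ?_ (hN i) hw
      rintro _ rfl
      exact hEp i a
    · rintro _ ⟨j, -, rfl⟩ _ rfl
      exact (htt a j).pow_left p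

end OpClosure

section WeylPairs

variable {R C : Type*} [CommRing R] [Ring C] [Algebra R C]

open LinearMap (mulLeft mulRight)

theorem commute_ad_mulLeft {a b : C} (h : Commute a b) :
    Commute (mulLeft R a - mulRight R a) (mulLeft R b) :=
  LinearMap.ext fun c => by
    simp only [Module.End.mul_apply, LinearMap.sub_apply, LinearMap.mulLeft_apply,
      LinearMap.mulRight_apply, mul_sub, ← mul_assoc, h.eq]

theorem commute_ad_mulRight {a b : C} (h : Commute a b) :
    Commute (mulLeft R a - mulRight R a) (mulRight R b) :=
  LinearMap.ext fun c => by
    simp only [Module.End.mul_apply, LinearMap.sub_apply, LinearMap.mulLeft_apply,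
      LinearMap.mulRight_apply, sub_mul, mul_assoc, h.eq]

theorem commute_ad_op_mulRight {a b : C} (h : Commute a b) :
    Commute (mulRight R a - mulLeft R a) (mulRight R b) :=
  LinearMap.ext fun c => by
    simp only [Module.End.mul_apply, LinearMap.sub_apply, LinearMap.mulLeft_apply,
      LinearMap.mulRight_apply, sub_mul, mul_assoc, h.eq]

theorem ad_mul_mulLeft {a b : C} (h : a * b = b * a + 1) :
    (mulLeft R a - mulRight R a) * mulLeft R b = mulLeft R b * (mulLeft R a - mulRight R a) + 1 :=
  LinearMap.ext fun c => by
    simp only [Module.End.mul_apply, LinearMap.sub_apply, LinearMap.add_apply,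
      LinearMap.mulLeft_apply, LinearMap.mulRight_apply, Module.End.one_apply, ← mul_assoc, h]
    noncomm_ring

theorem ad_mul_mulRight {a b : C} (h : b * a = a * b + 1) :
    (mulRight R a - mulLeft R a) * mulRight R b =
      mulRight R b * (mulRight R a - mulLeft R a) + 1 :=
  LinearMap.ext fun c => by
    simp only [Module.End.mul_apply, LinearMap.sub_apply, LinearMap.add_apply,
      LinearMap.mulLeft_apply, LinearMap.mulRight_apply, Module.End.one_apply, mul_assoc, h,
      sub_mul, mul_add, mul_one]
    abel

variable {p m n : ℕ} (hp : p.Prime) (hpC : (p : C) = 0) {x : Fin m → C} {y : Fin n → C}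
  (hx : ∀ i j, x i * x j = x j * x i) (hy : ∀ i j, y i * y j = y j * y i)
  (hyx : ∀ (k : ℕ) j (l : Fin n), (l : ℕ) < k → Commute (y l) (x j ^ p ^ k))
  (hxy : ∀ (k : ℕ) j (l : Fin m), (l : ℕ) < k → Commute (x l) (y j ^ p ^ k))
  (hd : ∀ (j : Fin m) (k : Fin n),
    y k ^ p ^ (j : ℕ) * x j ^ p ^ (k : ℕ) = x j ^ p ^ (k : ℕ) * y k ^ p ^ (j : ℕ) + 1)

variable (R) in
/-- The closure of `1` under left multiplication by the `x_i ^ q`. -/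
def leftClosure (x : Fin m → C) (q : ℕ) : Submodule R C :=
  opClosure (Set.range fun i => mulLeft R (x i ^ q)) 1

variable (R) in
/-- The closure of `1` under right multiplication by the `y_j ^ q`. -/
def rightClosure (y : Fin n → C) (q : ℕ) : Submodule R C :=
  opClosure (Set.range fun j => mulRight R (y j ^ q)) 1

theorem ad_eq_zero_of_mem_one (a : C) {v : C} (hv : v ∈ (1 : Submodule R C)) :
    (mulLeft R a - mulRight R a) v = 0 := by
  obtain ⟨r, rfl⟩ := Submodule.mem_one.1 hv
  simp [Algebra.commutes]

include hy in
theorem commute_of_mem_rightClosure {q : ℕ} {v : C} (hv : v ∈ rightClosure R y q) (k : Fin n)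
    (r : ℕ) : (mulLeft R (y k ^ r) - mulRight R (y k ^ r)) v = 0 := by
  refine map_eq_zero_of_mem_opClosure ?_ (fun w hw => ad_eq_zero_of_mem_one _ hw) hv
  rintro _ ⟨j, rfl⟩
  exact commute_ad_mulRight (Commute.pow_pow (hy k j) r q)

include hx in
theorem commute_of_mem_leftClosure {q : ℕ} {v : C} (hv : v ∈ leftClosure R x q) (k : Fin m)
    (r : ℕ) : (mulRight R (x k ^ r) - mulLeft R (x k ^ r)) v = 0 := by
  rw [← neg_eq_zero, ← LinearMap.neg_apply, neg_sub]
  refine map_eq_zero_of_mem_opClosure ?_ (fun w hw => ad_eq_zero_of_mem_one _ hw) hv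
  rintro _ ⟨j, rfl⟩
  exact commute_ad_mulLeft (Commute.pow_pow (hx k j) r q)

include hp hpC

include hx hy hyx hxy hd in
theorem mem_opClosure_mulLeft_pow {n' : ℕ} (hn' : n' ≤ n) {z : C}
    (hz : z ∈ opClosure (Set.range fun i => mulLeft R (x i ^ 1)) (rightClosure R y 1))
    (hcomm : ∀ j : Fin n, (j : ℕ) < n' → Commute z (y j)) :
    z ∈ opClosure (Set.range fun i => mulLeft R (x i ^ p ^ n')) (rightClosure R y 1) := by
  induction n' with
  | zero => simpa using hz
  | succ k ih =>
    specialize ih (by omega) fun j hj => hcomm j (by omega)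
    set K : Fin n := ⟨k, hn'⟩
    have h := mem_opClosure_pow_of_apply_eq_zero (R := R) hp
      (fun v => by rw [nsmul_eq_mul, hpC, zero_mul])
      (t := fun i => mulLeft R (x i ^ p ^ k))
      (E := fun i : Fin m => mulLeft R (y K ^ p ^ (i : ℕ)) - mulRight R (y K ^ p ^ (i : ℕ)))
      (fun i j => LinearMap.ext fun c => by
        have := Commute.pow_pow (hx i j) (p ^ k) (p ^ k)
        simp only [Module.End.mul_apply, LinearMap.mulLeft_apply, ← mul_assoc, this.eq])
      (fun i j hij => commute_ad_mulLeft ((hxy i K j hij).pow_left _).symm)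
      (fun i => ad_mul_mulLeft (hd i K))
      (fun i j => by
        rw [LinearMap.pow_mulLeft, ← pow_mul, ← pow_succ]
        exact commute_ad_mulLeft ((hyx (k + 1) j K k.lt_succ_self).pow_left _))
      Finset.univ (fun i v hv => commute_of_mem_rightClosure hy hv K _) (v := z)
      (by rwa [Finset.coe_univ, Set.image_univ])
      (fun i _ => by
        simp only [LinearMap.sub_apply, LinearMap.mulLeft_apply, LinearMap.mulRight_apply]
        exact sub_eq_zero.2 ((hcomm K k.lt_succ_self).pow_right _).symm)
    rw [Finset.coe_univ, Set.image_univ] at h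
    simpa only [LinearMap.pow_mulLeft, ← pow_mul, ← pow_succ] using h

include hx hy hyx hxy hd in
theorem mem_opClosure_mulRight_pow {m' q : ℕ} (hm' : m' ≤ m) {z : C}
    (hz : z ∈ opClosure (Set.range fun j => mulRight R (y j ^ 1)) (leftClosure R x q))
    (hcomm : ∀ i : Fin m, (i : ℕ) < m' → Commute z (x i)) :
    z ∈ opClosure (Set.range fun j => mulRight R (y j ^ p ^ m')) (leftClosure R x q) := by
  induction m' with
  | zero => simpa using hz
  | succ k ih =>
    specialize ih (by omega) fun j hj => hcomm j (by omega)
    set K : Fin m := ⟨k, hm'⟩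
    have h := mem_opClosure_pow_of_apply_eq_zero (R := R) hp
      (fun v => by rw [nsmul_eq_mul, hpC, zero_mul])
      (t := fun j => mulRight R (y j ^ p ^ k))
      (E := fun i : Fin n => mulRight R (x K ^ p ^ (i : ℕ)) - mulLeft R (x K ^ p ^ (i : ℕ)))
      (fun i j => LinearMap.ext fun c => by
        have := Commute.pow_pow (hy i j) (p ^ k) (p ^ k)
        simp only [Module.End.mul_apply, LinearMap.mulRight_apply, mul_assoc, this.eq])
      (fun i j hij => commute_ad_op_mulRight ((hyx i K j hij).pow_left _).symm)
      (fun i => ad_mul_mulRight (hd K i))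
      (fun i j => by
        rw [LinearMap.pow_mulRight, ← pow_mul, ← pow_succ]
        exact commute_ad_op_mulRight ((hxy (k + 1) j K k.lt_succ_self).pow_left _))
      Finset.univ (N := leftClosure R x q)
      (fun i v hv => commute_of_mem_leftClosure hx hv K _) (v := z)
      (by rwa [Finset.coe_univ, Set.image_univ])
      (fun i _ => by
        simp only [LinearMap.sub_apply, LinearMap.mulLeft_apply, LinearMap.mulRight_apply]
        exact sub_eq_zero.2 ((hcomm K k.lt_succ_self).pow_right _))
    rw [Finset.coe_univ, Set.image_univ] at h
    simpa only [LinearMap.pow_mulRight, ← pow_mul, ← pow_succ] using h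

omit hp hpC

theorem opClosure_mulLeft_rightClosure_le (x : Fin m → C) (y : Fin n → C) (q r : ℕ) :
    opClosure (Set.range fun i => mulLeft R (x i ^ q)) (rightClosure R y r) ≤
      opClosure (Set.range fun j => mulRight R (y j ^ r)) (leftClosure R x q) := by
  refine opClosure_opClosure_le.trans ?_
  rw [Set.union_comm]
  refine opClosure_le_opClosure_opClosure ?_
  rintro _ ⟨j, rfl⟩ _ ⟨i, rfl⟩
  exact LinearMap.ext fun c => by simp [mul_assoc]

theorem adjoin_mul_adjoin_le_opClosure (x : Fin m → C) (y : Fin n → C) :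
    Subalgebra.toSubmodule (Algebra.adjoin R (Set.range x)) *
      Subalgebra.toSubmodule (Algebra.adjoin R (Set.range y)) ≤
    opClosure (Set.range fun i => mulLeft R (x i ^ 1)) (rightClosure R y 1) := by
  have hright : ∀ b ∈ Algebra.adjoin R (Set.range y), ∀ w ∈ rightClosure R y 1,
      w * b ∈ rightClosure R y 1 := by
    intro b hb
    induction hb using Algebra.adjoin_induction with
    | mem s hs =>
      obtain ⟨j, rfl⟩ := hs
      intro w hw
      have h : mulRight R (y j ^ 1) w ∈ rightClosure R y 1 :=
        apply_mem_opClosure (Set.mem_range_self j) hw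
      rwa [LinearMap.mulRight_apply, pow_one] at h
    | algebraMap r =>
      intro w hw
      rw [← Algebra.commutes, ← Algebra.smul_def]
      exact Submodule.smul_mem _ r hw
    | add a b _ _ iha ihb => intro w hw; rw [mul_add]; exact add_mem (iha w hw) (ihb w hw)
    | mul a b _ _ iha ihb => intro w hw; rw [← mul_assoc]; exact ihb _ (iha w hw)
  set M := opClosure (Set.range fun i => mulLeft R (x i ^ 1)) (rightClosure R y 1)
  have hleft : ∀ a ∈ Algebra.adjoin R (Set.range x), ∀ w ∈ M, a * w ∈ M := by
    intro b hb
    induction hb using Algebra.adjoin_induction with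
    | mem s hs =>
      obtain ⟨j, rfl⟩ := hs
      intro w hw
      have h : mulLeft R (x j ^ 1) w ∈ M := apply_mem_opClosure (Set.mem_range_self j) hw
      rwa [LinearMap.mulLeft_apply, pow_one] at h
    | algebraMap r =>
      intro w hw
      rw [← Algebra.smul_def]
      exact Submodule.smul_mem _ r hw
    | add a b _ _ iha ihb => intro w hw; rw [add_mul]; exact add_mem (iha w hw) (ihb w hw)
    | mul a b _ _ iha ihb => intro w hw; rw [mul_assoc]; exact iha _ (ihb w hw)
  refine Submodule.mul_le.2 fun a ha b hb => hleft a ha b (le_opClosure _ _ ?_)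
  rw [← one_mul b]
  exact hright b hb 1 (le_opClosure _ _ (Submodule.one_le.1 le_rfl))

/-- Ordered monomials in a finite family. -/
def finMonomial (x : Fin m → C) (e : Fin m → ℕ) : C :=
  ((List.finRange m).map fun i => x i ^ e i).prod

theorem finMonomial_eq_commEval (hx : ∀ i j, x i * x j = x j * x i) (e : Fin m → ℕ) :
    finMonomial x e = commEval (R := R) x hx (∏ i, MvPolynomial.X i ^ e i) := by
  rw [Fin.prod_univ_def, map_list_prod, List.map_map, finMonomial]
  congr 2
  ext i
  simp

include hx in
theorem pow_mul_finMonomial (i : Fin m) (q : ℕ) (e : Fin m → ℕ) :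
    x i ^ q * finMonomial x (fun k => q * e k) =
      finMonomial x fun k => q * (e + Pi.single i 1 : Fin m → ℕ) k := by
  have h1 : x i ^ q = commEval (R := ℤ) x hx (MvPolynomial.X i ^ q) := by simp
  rw [finMonomial_eq_commEval (R := ℤ) hx, finMonomial_eq_commEval (R := ℤ) hx, h1, ← map_mul]
  congr 1
  simp only [Pi.add_apply, mul_add, pow_add, Finset.prod_mul_distrib]
  rw [mul_comm]
  congr 1
  rw [Finset.prod_eq_single i (fun k _ hk => by simp [hk]) (by simp)]
  simp

include hx in
theorem finMonomial_mul_pow (i : Fin m) (q : ℕ) (e : Fin m → ℕ) :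
    finMonomial x (fun k => q * e k) * x i ^ q =
      finMonomial x fun k => q * (e + Pi.single i 1 : Fin m → ℕ) k := by
  rw [← pow_mul_finMonomial hx]
  refine (Commute.list_prod_left _ _ fun a ha => ?_)
  obtain ⟨k, -, rfl⟩ := List.mem_map.1 ha
  exact Commute.pow_pow (hx k i) _ _

theorem map_finMonomial {B : Type*} [Ring B] [Algebra R B] (f : B →ₐ[R] C) (x : Fin m → B)
    (e : Fin m → ℕ) : f (finMonomial x e) = finMonomial (fun i => f (x i)) e := by
  simp only [finMonomial, map_list_prod, List.map_map, Function.comp_def, map_pow]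

theorem finMonomial_zero (q : ℕ) : finMonomial x (fun _ => q * 0) = 1 := by
  simp [finMonomial]

include hx hy in
theorem opClosure_le_span_finMonomial (q r : ℕ) :
    opClosure (Set.range fun j => mulRight R (y j ^ r)) (leftClosure R x q) ≤
      Submodule.span R {w | ∃ (e : Fin m → ℕ) (f : Fin n → ℕ), w =
        finMonomial x (fun k => q * e k) * finMonomial y (fun k => r * f k)} := by
  set S := {w | ∃ (e : Fin m → ℕ) (f : Fin n → ℕ), w = finMonomial x (fun k => q * e k) * finMonomial y (fun k => r * f k)}
  have h1 : leftClosure R x q ≤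
      Submodule.span R {w | ∃ e : Fin m → ℕ, w = finMonomial x (fun k => q * e k)} := by
    refine opClosure_le (Submodule.one_le.2
      (Submodule.subset_span ⟨fun _ => 0, (finMonomial_zero q).symm⟩)) ?_
    rintro _ ⟨i, rfl⟩
    refine (Submodule.span_le (p := (Submodule.span R _).comap (mulLeft R (x i ^ q)))).2 ?_
    rintro _ ⟨e, rfl⟩
    exact Submodule.subset_span ⟨_, pow_mul_finMonomial hx i q e⟩
  refine opClosure_le (h1.trans (Submodule.span_mono ?_)) ?_
  · rintro _ ⟨e, rfl⟩
    exact ⟨e, fun _ => 0, by rw [finMonomial_zero, mul_one]⟩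
  · rintro _ ⟨j, rfl⟩
    refine (Submodule.span_le (p := (Submodule.span R S).comap (mulRight R (y j ^ r)))).2 ?_
    rintro _ ⟨e, f, rfl⟩
    exact Submodule.subset_span ⟨e, _, by
      rw [LinearMap.mulRight_apply, mul_assoc, finMonomial_mul_pow hy]⟩

include hp hpC hx hy hyx hxy hd in
theorem centralizer_eq_span_finMonomial
    (hspan : Subalgebra.toSubmodule (Algebra.adjoin R (Set.range x)) *
      Subalgebra.toSubmodule (Algebra.adjoin R (Set.range y)) = ⊤)
    {m' n' : ℕ} (hm' : m' ≤ m) (hn' : n' ≤ n) :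
    Subalgebra.toSubmodule (Subalgebra.centralizer R
      ({z | ∃ i : Fin m, (i : ℕ) < m' ∧ z = x i} ∪ {z | ∃ j : Fin n, (j : ℕ) < n' ∧ z = y j})) =
    Submodule.span R {w | ∃ (e : Fin m → ℕ) (f : Fin n → ℕ), w =
      finMonomial x (fun k => p ^ n' * e k) * finMonomial y (fun k => p ^ m' * f k)} := by
  apply le_antisymm
  · intro z hz
    rw [Subalgebra.mem_toSubmodule, Subalgebra.mem_centralizer_iff] at hz
    have h0 := adjoin_mul_adjoin_le_opClosure (R := R) x y (hspan ▸ Submodule.mem_top : z ∈ _)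
    have h1 := mem_opClosure_mulLeft_pow hp hpC hx hy hyx hxy hd hn' h0
      fun j hj => (hz _ (Or.inr ⟨j, hj, rfl⟩)).symm
    have h2 := mem_opClosure_mulRight_pow hp hpC hx hy hyx hxy hd hm'
      (opClosure_mulLeft_rightClosure_le x y _ _ h1)
      fun i hi => (hz _ (Or.inl ⟨i, hi, rfl⟩)).symm
    exact opClosure_le_span_finMonomial hx hy _ _ h2
  · refine Submodule.span_le.2 ?_
    rintro _ ⟨e, f, rfl⟩
    rw [SetLike.mem_coe, Subalgebra.mem_toSubmodule]
    refine mul_mem (list_prod_mem fun a ha => ?_) (list_prod_mem fun a ha => ?_)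
    · obtain ⟨k, -, rfl⟩ := List.mem_map.1 ha
      rw [pow_mul]
      refine pow_mem ((Subalgebra.mem_centralizer_iff R).2 ?_) _
      rintro _ (⟨i, hi, rfl⟩ | ⟨j, hj, rfl⟩)
      · exact Commute.pow_right (hx i k) _
      · exact hyx _ k j hj
    · obtain ⟨k, -, rfl⟩ := List.mem_map.1 ha
      rw [pow_mul]
      refine pow_mem ((Subalgebra.mem_centralizer_iff R).2 ?_) _
      rintro _ (⟨i, hi, rfl⟩ | ⟨j, hj, rfl⟩)
      · exact hxy _ k i hi
      · exact Commute.pow_right (hy j k) _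

end WeylPairs

section Quotients

variable {p : ℕ} (hp : p.Prime) {R : Type*} [CommRing R] {m n : ℕ}
  {c : ℕ+ → ℕ+ → MvPolynomial (ℕ+ ⊕ₗ ℕ+) ℤ} (hc : IsCFamily c) {C : Type*} [Ring C] [Algebra R C]
  {π : Bmn R p c m n →ₐ[R] C} (hπ : Function.Surjective π)

include hπ in
theorem adjoin_generators_eq_top :
    Algebra.adjoin R (Set.range (fun i => π (gx R p c m n i)) ∪
      Set.range (fun j => π (gy R p c m n j))) = ⊤ := by
  set q := π.comp (RingQuot.mkAlgHom R (BmnRel R p c m n))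
  have hq : Function.Surjective q := hπ.comp (RingQuot.mkAlgHom_surjective R _)
  rw [← (AlgHom.range_eq_top q).2 hq, ← Algebra.map_top, ← FreeAlgebra.adjoin_range_ι,
    AlgHom.map_adjoin, ← Set.range_comp, ← Set.Sum.elim_range]
  congr 2
  ext v
  rcases v with v | v <;> rfl

include hp hc hπ in
theorem adjoin_gx_mul_adjoin_gy_eq_top :
    Subalgebra.toSubmodule (Algebra.adjoin R (Set.range fun i => π (gx R p c m n i))) *
      Subalgebra.toSubmodule (Algebra.adjoin R (Set.range fun j => π (gy R p c m n j))) = ⊤ := by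
  rw [eq_top_iff, ← Algebra.top_toSubmodule, ← adjoin_generators_eq_top hπ]
  refine adjoin_le_adjoin_mul_adjoin _ _ fun i j => ?_
  set A := Algebra.adjoin R (Set.range (fun i => π (gx R p c m n i)) ∪
    (fun j => π (gy R p c m n j)) '' {k | k < j})
  have h : Algebra.adjoin ℤ (Set.range (prodX π) ∪ prodY π '' {k | k < j}) ≤
      (A.restrictScalars ℤ).comap (AlgHom.snd ℤ BQ C) := by
    refine Algebra.adjoin_le ?_
    rintro _ (⟨k, rfl⟩ | ⟨k, hk, rfl⟩)
    · exact Algebra.subset_adjoin (Or.inl ⟨k, rfl⟩)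
    · exact Algebra.subset_adjoin (Or.inr ⟨k, hk, rfl⟩)
  exact h (prodY_mul_prodX_sub_mem hp hc π i j)

end Quotients

/-- Fix a prime `p`, a commutative ring `R` of characteristic `p`, `m, n ∈ ℕ` and a
quotient `C = B_{m,n}(R)/I` of `B_{m,n}(R)` by an ideal (encoded by a surjective
`R`-algebra homomorphism `π : B_{m,n}(R) → C`).  For all `m' ≤ m` and `n' ≤ n`, the
centralizer in `C` of the images of `x_0, …, x_{m'−1}, y_0, …, y_{n'−1}` equals the image
under `π` of the `R`-submodule of `B_{m,n}(R)` spanned by the monomials in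
`x_0^{p^{n'}}, …, x_{m−1}^{p^{n'}}` times the monomials in `y_0^{p^{m'}}, …, y_{n−1}^{p^{m'}}`.
In particular the center of `C` is the image of the span of the monomials in
`x_0^{p^n}, …, x_{m−1}^{p^n}, y_0^{p^m}, …, y_{n−1}^{p^m}`. -/
theorem bmn_quotient_centralizer (p : ℕ) (hp : p.Prime) (R : Type*) [CommRing R] [CharP R p]
    (m n : ℕ) (c : ℕ+ → ℕ+ → MvPolynomial (ℕ+ ⊕ₗ ℕ+) ℤ) (hc : IsCFamily c)
    (C : Type*) [Ring C] [Algebra R C]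
    (π : Bmn R p c m n →ₐ[R] C) (hπ : Function.Surjective π) :
    (∀ m' n' : ℕ, m' ≤ m → n' ≤ n →
      (Subalgebra.centralizer R
          ({z | ∃ i : Fin m, (i : ℕ) < m' ∧ z = π (gx R p c m n i)} ∪
           {z | ∃ j : Fin n, (j : ℕ) < n' ∧ z = π (gy R p c m n j)}) : Set C) =
        π '' (Submodule.span R {w : Bmn R p c m n |
          ∃ (e : Fin m → ℕ) (f : Fin n → ℕ),
            w = (((List.finRange m).map fun i => gx R p c m n i ^ (p ^ n' * e i)).prod) *
                (((List.finRange n).map fun j => gy R p c m n j ^ (p ^ m' * f j)).prod)} :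
          Set (Bmn R p c m n))) ∧
    ((Subalgebra.center R C : Set C) =
      π '' (Submodule.span R {w : Bmn R p c m n |
        ∃ (e : Fin m → ℕ) (f : Fin n → ℕ),
          w = (((List.finRange m).map fun i => gx R p c m n i ^ (p ^ n * e i)).prod) *
              (((List.finRange n).map fun j => gy R p c m n j ^ (p ^ m * f j)).prod)} :
        Set (Bmn R p c m n))) := by
  have hpC : (p : C) = 0 := by
    rw [← map_natCast (algebraMap R C), CharP.cast_eq_zero, map_zero]
  have key := fun (m' n' : ℕ) (hm' : m' ≤ m) (hn' : n' ≤ n) =>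
    centralizer_eq_span_finMonomial (R := R) hp hpC
      (fun i j => by rw [← map_mul, gx_comm, map_mul])
      (fun i j => by rw [← map_mul, gy_comm, map_mul])
      (fun k j l h => commute_gy_gx_pow hp hc π hpC j l h)
      (fun k j l h => commute_gx_gy_pow hp hc π hpC j l h)
      (gy_pow_mul_gx_pow hp hc π hpC) (adjoin_gx_mul_adjoin_gy_eq_top hp hc hπ) hm' hn'
  have main : ∀ m' n' : ℕ, m' ≤ m → n' ≤ n →
      (Subalgebra.centralizer R
          ({z | ∃ i : Fin m, (i : ℕ) < m' ∧ z = π (gx R p c m n i)} ∪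
           {z | ∃ j : Fin n, (j : ℕ) < n' ∧ z = π (gy R p c m n j)}) : Set C) =
        π '' (Submodule.span R {w : Bmn R p c m n |
          ∃ (e : Fin m → ℕ) (f : Fin n → ℕ),
            w = (((List.finRange m).map fun i => gx R p c m n i ^ (p ^ n' * e i)).prod) *
                (((List.finRange n).map fun j => gy R p c m n j ^ (p ^ m' * f j)).prod)} :
          Set (Bmn R p c m n)) := by
    intro m' n' hm' hn'
    have h := congrArg (fun M : Submodule R C => (M : Set C)) (key m' n' hm' hn')
    refine h.trans ?_
    rw [← AlgHom.coe_toLinearMap, ← Submodule.map_coe, Submodule.map_span]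
    congr 2
    ext z
    have hmon : ∀ (e : Fin m → ℕ) (f : Fin n → ℕ),
        π.toLinearMap (finMonomial (gx R p c m n) (fun k => p ^ n' * e k) *
          finMonomial (gy R p c m n) fun k => p ^ m' * f k) =
        finMonomial (fun i => π (gx R p c m n i)) (fun k => p ^ n' * e k) *
          finMonomial (fun j => π (gy R p c m n j)) fun k => p ^ m' * f k := fun e f => by
      rw [AlgHom.toLinearMap_apply, map_mul, map_finMonomial, map_finMonomial]
    constructor
    · rintro ⟨e, f, rfl⟩
      exact ⟨_, ⟨e, f, rfl⟩, hmon e f⟩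
    · rintro ⟨_, ⟨e, f, rfl⟩, rfl⟩
      exact ⟨e, f, hmon e f⟩
  refine ⟨main, (?_ : _ = _).trans (main m n le_rfl le_rfl)⟩
  have hgen : ({z | ∃ i : Fin m, (i : ℕ) < m ∧ z = π (gx R p c m n i)} ∪
      {z | ∃ j : Fin n, (j : ℕ) < n ∧ z = π (gy R p c m n j)} : Set C) =
      Set.range (fun i => π (gx R p c m n i)) ∪ Set.range (fun j => π (gy R p c m n j)) := by
    ext z
    simp [eq_comm]
  rw [hgen, ← Subalgebra.centralizer_univ, ← Algebra.coe_top (R := R),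
    ← adjoin_generators_eq_top hπ]
  refine congrArg _ (le_antisymm (Subalgebra.centralizer_le R _ _ Algebra.subset_adjoin) ?_)
  exact (Subalgebra.le_centralizer_iff _ _).1
    (Algebra.adjoin_le fun z hz w hw => (hw z hz).symm)

end
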